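/- arXiv:2306.17556 — 12 statements merged into one kernel-verified Lean document; each statement's English description precedes it below -/
import Mathlib

section
/- For every integer t ≥ 4, the polynomial f(x;t) = x⁴ − t·x³ − x² + t·x + 1 is irreducible over ℚ. -/
open Polynomial

theorem Polynomial.Monic.eq_X_sq_add {R : Type*} [CommRing R] {p : R[X]} (hp : p.Monic)
    (hd : p.natDegree = 2) : p = X ^ 2 + C (p.coeff 1) * X + C (p.coeff 0) := by
  have h2 : p.coeff 2 = 1 := hd ▸ hp.coeff_natDegree
  conv_lhs => rw [p.as_sum_range_C_mul_X_pow, hd]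
  simp only [Finset.sum_range_succ, Finset.sum_range_zero, h2, map_one]
  ring

theorem natDegree_quartic (t : ℤ) :
    (X ^ 4 - C t * X ^ 3 - X ^ 2 + C t * X + 1 : ℤ[X]).natDegree = 4 := by
  compute_degree!

theorem monic_quartic (t : ℤ) :
    (X ^ 4 - C t * X ^ 3 - X ^ 2 + C t * X + 1 : ℤ[X]).Monic := by
  monicity!

theorem eval_quartic_ne_zero (t r : ℤ) :
    (X ^ 4 - C t * X ^ 3 - X ^ 2 + C t * X + 1 : ℤ[X]).eval r ≠ 0 := by
  intro h
  simp only [eval_add, eval_sub, eval_mul, eval_pow, eval_X, eval_C, eval_one] at h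
  have hr : r ∣ 1 := ⟨-(r ^ 3 - t * r ^ 2 - r + t), by linear_combination h⟩
  rcases Int.isUnit_iff.mp (isUnit_of_dvd_one hr) with rfl | rfl <;> ring_nf at h <;> omega

theorem quadratic_mul_quadratic_ne_quartic {t : ℤ} (ht : 4 ≤ t) (a b c d : ℤ) :
    (X ^ 2 + C a * X + C b) * (X ^ 2 + C c * X + C d) ≠
      (X ^ 4 - C t * X ^ 3 - X ^ 2 + C t * X + 1 : ℤ[X]) := by
  intro h
  have key : (X ^ 2 + C a * X + C b) * (X ^ 2 + C c * X + C d) =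
      X ^ 4 + C (a + c) * X ^ 3 + C (b + d + a * c) * X ^ 2 + C (a * d + b * c) * X
        + C (b * d) := by
    simp only [map_add, map_mul]
    ring
  rw [key] at h
  have h0 := congrArg (coeff · 0) h
  have h1 := congrArg (coeff · 1) h
  have h2 := congrArg (coeff · 2) h
  have h3 := congrArg (coeff · 3) h
  simp only [coeff_add, coeff_sub, coeff_C_mul, coeff_X_pow, coeff_X, coeff_C,
    coeff_one] at h0 h1 h2 h3
  norm_num at h0 h1 h2 h3
  rcases Int.mul_eq_one_iff_eq_one_or_neg_one.mp h0 with ⟨rfl, rfl⟩ | ⟨rfl, rfl⟩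
  · omega
  · have hac : a * c = 1 := by linarith
    rcases Int.mul_eq_one_iff_eq_one_or_neg_one.mp hac with ⟨rfl, rfl⟩ | ⟨rfl, rfl⟩ <;> omega

theorem irreducible_quartic_int {t : ℤ} (ht : 4 ≤ t) :
    Irreducible (X ^ 4 - C t * X ^ 3 - X ^ 2 + C t * X + 1 : ℤ[X]) := by
  have hdeg := natDegree_quartic t
  rw [(monic_quartic t).irreducible_iff_natDegree']
  refine ⟨fun h => by rw [h, natDegree_one] at hdeg; omega, fun p q hp hq hpq hmem => ?_⟩
  have hsum : p.natDegree + q.natDegree = 4 := by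
    rw [← hp.natDegree_mul hq, hpq, hdeg]
  rw [hdeg, Finset.mem_Ioc] at hmem
  obtain hq1 | hq2 : q.natDegree = 1 ∨ q.natDegree = 2 := by omega
  · apply eval_quartic_ne_zero t (-q.coeff 0)
    rw [← hpq, eval_mul, hq.eq_X_add_C hq1]
    simp
  · rw [hp.eq_X_sq_add (by omega), hq.eq_X_sq_add hq2] at hpq
    exact quadratic_mul_quadratic_ne_quartic ht _ _ _ _ hpq

/-- For every integer `t ≥ 4`, the polynomial `f(x;t) = x⁴ − t·x³ − x² + t·x + 1`
is irreducible over `ℚ`. -/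
theorem stmt_0 (t : ℤ) (ht : 4 ≤ t) :
    Irreducible (X ^ 4 - C (t : ℚ) * X ^ 3 - X ^ 2 + C (t : ℚ) * X + 1 : Polynomial ℚ) := by
  have h := ((monic_quartic t).irreducible_iff_irreducible_map_fraction_map (K := ℚ)).mp
    (irreducible_quartic_int ht)
  simpa using h
end

section
/- For every integer t ≥ 4, the polynomial f(x;t) = x⁴ − t·x³ − x² + t·x + 1 has four distinct real roots (i.e., it splits over ℝ with all roots real and simple). -/
open Polynomial

/-- For every integer `t ≥ 4`, the polynomial `f(x;t) = x⁴ − t·x³ − x² + t·x + 1`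
has four distinct real roots: over `ℝ` its multiset of roots has cardinality 4
(so it splits with all roots real) and has no duplicates (all roots simple). -/
theorem stmt_1 (t : ℤ) (ht : 4 ≤ t) :
    (X ^ 4 - C (t : ℝ) * X ^ 3 - X ^ 2 + C (t : ℝ) * X + 1 : Polynomial ℝ).roots.card = 4 ∧
    (X ^ 4 - C (t : ℝ) * X ^ 3 - X ^ 2 + C (t : ℝ) * X + 1 : Polynomial ℝ).roots.Nodup := by
  set p : Polynomial ℝ := X ^ 4 - C (t : ℝ) * X ^ 3 - X ^ 2 + C (t : ℝ) * X + 1 with hp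
  have ht' : (4 : ℝ) ≤ t := by exact_mod_cast ht
  have hdeg : p.natDegree = 4 := by rw [hp]; compute_degree!
  have hp0 : p ≠ 0 := by
    rintro h
    simp [h] at hdeg
  have heval (x : ℝ) : p.eval x = x ^ 4 - t * x ^ 3 - x ^ 2 + t * x + 1 := by simp [hp]
  have hneg : p.eval (-1 / 2) < 0 := by rw [heval]; linarith
  have htwo : p.eval 2 < 0 := by rw [heval]; linarith
  have hm : 0 < p.eval (-1) := by rw [heval]; linarith
  have hz : 0 < p.eval 0 := by rw [heval]; linarith
  have hone : 0 < p.eval 1 := by rw [heval]; linarith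
  have htop : 0 < p.eval (t : ℝ) := by rw [heval]; ring_nf; norm_num
  obtain ⟨a, ⟨_, ha⟩, ra⟩ := intermediate_value_Ioo' (by norm_num) p.continuousOn ⟨hneg, hm⟩
  obtain ⟨b, ⟨hb, hb'⟩, rb⟩ := intermediate_value_Ioo (by norm_num) p.continuousOn ⟨hneg, hz⟩
  obtain ⟨c, ⟨hc, hc'⟩, rc⟩ := intermediate_value_Ioo' (by norm_num) p.continuousOn ⟨htwo, hone⟩
  obtain ⟨d, ⟨hd, _⟩, rd⟩ := intermediate_value_Ioo (by linarith) p.continuousOn ⟨htwo, htop⟩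
  have hsub : ({a, b, c, d} : Finset ℝ) ⊆ p.roots.toFinset := by
    intro x hx
    simp only [Finset.mem_insert, Finset.mem_singleton] at hx
    rw [Multiset.mem_toFinset, mem_roots hp0, IsRoot.def]
    rcases hx with rfl | rfl | rfl | rfl <;> assumption
  have hcard : ({a, b, c, d} : Finset ℝ).card = 4 := by
    rw [Finset.card_insert_of_notMem, Finset.card_insert_of_notMem,
      Finset.card_insert_of_notMem, Finset.card_singleton] <;> grind
  have hlower := Finset.card_le_card hsub
  have hdedup := p.roots.toFinset_card_le
  have hupper := p.card_roots'
  refine ⟨by omega, ?_⟩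
  rw [← Multiset.toFinset_card_eq_card_iff_nodup]
  omega
end

section
/- For every integer t ≥ 4, any root α of f(x;t) = x⁴ − t·x³ − x² + t·x + 1 is an exceptional unit of the number field ℚ(α): both α and 1 − α are units in the ring of integers of ℚ(α). -/
open Polynomial NumberField

/-- A root of `x⁴ - t x³ - x² + t x + 1` is integral over `ℤ`. -/
theorem isIntegral_of_quartic_eq_zero {R : Type*} [CommRing R] (t : ℤ) {α : R}
    (h : α ^ 4 - t * α ^ 3 - α ^ 2 + t * α + 1 = 0) : IsIntegral ℤ α := by
  refine ⟨X ^ 4 - C t * X ^ 3 - X ^ 2 + C t * X + 1, by monicity!, ?_⟩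
  simpa [-eq_intCast, -map_intCast, eval₂_C] using h

/-- For every integer `t ≥ 4`, any root `α` of `f(x;t) = x⁴ − t·x³ − x² + t·x + 1`
is an exceptional unit of `ℚ(α)`: both `α` and `1 − α` are units in the ring of
integers of `ℚ(α)`. -/
theorem stmt_3 (t : ℤ) (ht : 4 ≤ t) (K : Type*) [Field K] [NumberField K] (α : K)
    (hα : Polynomial.aeval α
      (X ^ 4 - C (t : ℚ) * X ^ 3 - X ^ 2 + C (t : ℚ) * X + 1 : Polynomial ℚ) = 0)
    (hgen : IntermediateField.adjoin ℚ {α} = ⊤) :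
    (∃ u : (𝓞 K)ˣ, ((u : 𝓞 K) : K) = α) ∧
    (∃ v : (𝓞 K)ˣ, ((v : 𝓞 K) : K) = 1 - α) := by
  have h : α ^ 4 - (t : K) * α ^ 3 - α ^ 2 + (t : K) * α + 1 = 0 := by simpa using hα
  obtain ⟨a, rfl⟩ : ∃ a : 𝓞 K, (a : K) = α :=
    ⟨⟨α, isIntegral_of_quartic_eq_zero t h⟩, rfl⟩
  have ha : a * (a - t) * (a + 1) * (1 - a) = 1 := by
    apply RingOfIntegers.coe_injective
    simp only [map_mul, map_sub, map_add, map_one, map_intCast]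
    linear_combination -h
  refine ⟨⟨Units.mkOfMulEqOne a ((a - t) * (a + 1) * (1 - a)) ?_, rfl⟩,
    ⟨Units.mkOfMulEqOne (1 - a) (a * (a - t) * (a + 1)) ?_, ?_⟩⟩
  · linear_combination ha
  · linear_combination ha
  · simp
end

section
/- For every squarefree integer d ≥ 2 there exist integers t ≥ 4 and s ≥ 1 with t² − d·s² = 4; consequently ℚ(√d) = ℚ(√(t² − 4)), so the real quadratic field ℚ(√d) is contained in the exceptional quartic field K_t generated by a root of f(x;t) = x⁴ − t·x³ − x² + t·x + 1. -/
open Polynomial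

theorem not_isSquare_of_squarefree {d : ℤ} (hd : Squarefree d) (hd2 : 2 ≤ d) : ¬IsSquare d := by
  rintro ⟨r, rfl⟩
  rcases Int.isUnit_iff.mp (hd r dvd_rfl) with rfl | rfl <;> norm_num at hd2

/-- If `x` is a root of `x⁴ − t·x³ − x² + t·x + 1`, then `u = x − x⁻¹` satisfies
`u² − t·u + 1 = 0`, so `2 * u − t` is a square root of `t² − 4`. -/
theorem exists_sq_eq_of_quartic_root {K : Type*} [Field K] {d t s x : K} (hs : s ≠ 0)
    (hts : t ^ 2 - d * s ^ 2 = 4) (hx : x ^ 4 - t * x ^ 3 - x ^ 2 + t * x + 1 = 0) :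
    ∃ γ : K, γ ^ 2 = d := by
  have hx0 : x ≠ 0 := by
    rintro rfl
    simp at hx
  have hu : (x - x⁻¹) ^ 2 - t * (x - x⁻¹) + 1 = 0 := by
    field_simp
    linear_combination hx
  refine ⟨(2 * (x - x⁻¹) - t) / s, ?_⟩
  rw [div_pow, div_eq_iff (pow_ne_zero 2 hs)]
  linear_combination 4 * hu + hts

/-- For every squarefree integer `d ≥ 2` there exist integers `t ≥ 4` and
`s ≥ 1` with `t² − d·s² = 4` (so that `t² − 4 = d·s²` and hence
`ℚ(√d) = ℚ(√(t² − 4))`); consequently, for any field `K` generated over `ℚ` by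
a root `α` of `f(x;t) = x⁴ − t·x³ − x² + t·x + 1`, `K` contains a square root
of `d`, i.e. the real quadratic field `ℚ(√d)` is contained in the exceptional
quartic field `K_t`. -/
theorem stmt_6 (d : ℤ) (hd : Squarefree d) (hd2 : 2 ≤ d) :
    ∃ t s : ℤ, 4 ≤ t ∧ 1 ≤ s ∧ t ^ 2 - d * s ^ 2 = 4 ∧
      ∀ (K : Type) [Field K] [NumberField K] (α : K),
        Polynomial.aeval α
          (X ^ 4 - C (t : ℚ) * X ^ 3 - X ^ 2 + C (t : ℚ) * X + 1 : Polynomial ℚ) = 0 →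
        IntermediateField.adjoin ℚ {α} = ⊤ →
        ∃ γ : K, γ ^ 2 = (d : K) := by
  obtain ⟨a, hx, hy⟩ := Pell.Solution₁.exists_pos_of_not_isSquare (by lia : 0 < d)
    (not_isSquare_of_squarefree hd hd2)
  have hpell : (2 * a.x) ^ 2 - d * (2 * a.y) ^ 2 = 4 := by linear_combination 4 * a.prop
  refine ⟨2 * a.x, 2 * a.y, by lia, by lia, hpell, fun K _ _ α hα _ => ?_⟩
  refine exists_sq_eq_of_quartic_root (t := ((2 * a.x : ℤ) : K)) (s := ((2 * a.y : ℤ) : K))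
    (Int.cast_ne_zero.mpr (by lia)) (by exact_mod_cast hpell) (x := α) ?_
  simpa using hα
end

section
/- For every integer t ≥ 4, the Galois group of the splitting field of f(x;t) = x⁴ − t·x³ − x² + t·x + 1 over ℚ is isomorphic to the dihedral group D₄ of order 8. -/
open Polynomial

section Group

/-- The action of the dihedral group of order `2n` on the vertices of a regular `n`-gon. -/
def DihedralGroup.toPerm (n : ℕ) : DihedralGroup n →* Equiv.Perm (ZMod n) :=
  MonoidHom.mk'
    (fun g => match g with
      | .r i => Equiv.addRight i
      | .sr i => Equiv.subLeft (-i))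
    (by
      rintro (i | i) (j | j) <;> ext x <;>
        simp only [DihedralGroup.r_mul_r, DihedralGroup.r_mul_sr, DihedralGroup.sr_mul_r,
          DihedralGroup.sr_mul_sr, Equiv.Perm.mul_apply, Equiv.coe_addRight,
          Equiv.subLeft_apply] <;> ring_nf)

theorem DihedralGroup.toPerm_four_injective : Function.Injective (DihedralGroup.toPerm 4) := by
  decide

theorem nonempty_mulEquiv_of_card_eq_prime_pow_factorization {G H P : Type*} [Group G] [Group H]
    [Group P] [Finite P] (p : ℕ) [Fact p.Prime] (f : G →* P) (g : H →* P)
    (hf : Function.Injective f) (hg : Function.Injective g)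
    (hG : Nat.card G = p ^ (Nat.card P).factorization p)
    (hH : Nat.card H = p ^ (Nat.card P).factorization p) : Nonempty (G ≃* H) := by
  have ef := MonoidHom.ofInjective hf
  have eg := MonoidHom.ofInjective hg
  let S : Sylow p P := Sylow.ofCard f.range (by rw [← hG, Nat.card_congr ef.toEquiv])
  let T : Sylow p P := Sylow.ofCard g.range (by rw [← hH, Nat.card_congr eg.toEquiv])
  exact ⟨ef.trans ((Sylow.equiv S T).trans eg.symm)⟩

theorem nonempty_mulEquiv_dihedralGroup_four {G : Type*} [Group G] {α : Type*}
    (hα : Nat.card α ≤ 4) [Finite α] (f : G →* Equiv.Perm α) (hf : Function.Injective f)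
    (hG : Nat.card G = 8) : Nonempty (G ≃* DihedralGroup 4) := by
  have : Nonempty (α ↪ ZMod 4) := by
    have := Fintype.ofFinite α
    rw [Function.Embedding.nonempty_iff_card_le, ← Nat.card_eq_fintype_card, ZMod.card]
    exact hα
  obtain ⟨ι⟩ := this
  have h8 : 2 ^ (Nat.card (Equiv.Perm (ZMod 4))).factorization 2 = 8 := by
    rw [Nat.card_perm, Nat.card_zmod,
      show Nat.factorial 4 = 2 ^ 3 * 3 by decide,
      Nat.factorization_mul (by norm_num) (by norm_num), Nat.factorization_pow]
    simp [Nat.prime_two.factorization, Nat.prime_three.factorization]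
  exact nonempty_mulEquiv_of_card_eq_prime_pow_factorization 2
    ((Equiv.Perm.viaEmbeddingHom ι).comp f) (DihedralGroup.toPerm 4)
    ((Equiv.Perm.viaEmbeddingHom_injective ι).comp hf) DihedralGroup.toPerm_four_injective
    (hG.trans h8.symm) (by rw [h8, DihedralGroup.nat_card])

end Group

section Quadratic

open IntermediateField

variable {F E : Type*} [Field F] [Field E] [Algebra F E] {s : E} {k : F}

theorem isIntegral_of_sq_eq (hs : s ^ 2 = algebraMap F E k) : IsIntegral F s :=
  .of_pow two_pos (hs ▸ isIntegral_algebraMap)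

theorem finrank_adjoin_sqrt (hs : s ^ 2 = algebraMap F E k) (hk : ¬ IsSquare k) :
    Module.finrank F F⟮s⟯ = 2 := by
  have hirr : Irreducible (X ^ 2 - C k) :=
    (X_pow_sub_C_irreducible_iff_of_prime Nat.prime_two).2
      fun b hb => hk ⟨b, by rw [← hb, sq]⟩
  rw [adjoin.finrank (isIntegral_of_sq_eq hs),
    ← minpoly.eq_of_irreducible_of_monic hirr (by simp [hs]) (monic_X_pow_sub_C k two_ne_zero),
    natDegree_X_pow_sub_C]

theorem exists_eq_add_mul_sqrt (hs : s ^ 2 = algebraMap F E k) {x : E} (hx : x ∈ F⟮s⟯) :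
    ∃ u v : F, x = algebraMap F E u + algebraMap F E v * s := by
  rw [← mem_toSubalgebra,
    adjoin_simple_toSubalgebra_of_isAlgebraic (isIntegral_of_sq_eq hs).isAlgebraic] at hx
  induction hx using Algebra.adjoin_induction with
  | mem x hx => exact ⟨0, 1, by simpa using hx⟩
  | algebraMap r => exact ⟨r, 0, by simp⟩
  | add x y _ _ hx hy =>
    obtain ⟨u, v, rfl⟩ := hx
    obtain ⟨u', v', rfl⟩ := hy
    exact ⟨u + u', v + v', by simp only [map_add]; ring⟩
  | mul x y _ _ hx hy =>
    obtain ⟨u, v, rfl⟩ := hx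
    obtain ⟨u', v', rfl⟩ := hy
    refine ⟨u * u' + v * v' * k, u * v' + v * u', ?_⟩
    simp only [map_add, map_mul, ← hs]
    ring

theorem eq_of_add_mul_sqrt_eq (hs : s ^ 2 = algebraMap F E k) (hk : ¬ IsSquare k)
    {u v u' v' : F} (h : algebraMap F E u + algebraMap F E v * s =
      algebraMap F E u' + algebraMap F E v' * s) : u = u' ∧ v = v' := by
  have hv : v = v' := by
    by_contra hne
    refine hk ⟨(u' - u) / (v - v'), (algebraMap F E).injective ?_⟩
    have hne' : algebraMap F E v - algebraMap F E v' ≠ 0 := by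
      rw [← map_sub]
      simpa [sub_eq_zero] using hne
    have : s = (algebraMap F E u' - algebraMap F E u) /
        (algebraMap F E v - algebraMap F E v') := by
      rw [eq_div_iff hne']
      linear_combination h
    rw [← hs, sq, map_mul, map_div₀, map_sub, map_sub, ← this]
  subst hv
  exact ⟨(algebraMap F E).injective (add_right_cancel h), rfl⟩

theorem isSquare_norm_of_isSquare (hs : s ^ 2 = algebraMap F E k) (hk : ¬ IsSquare k)
    {p q : F} {x : F⟮s⟯}
    (hx : (x : E) = algebraMap F E p + algebraMap F E q * s) (h : IsSquare x) :
    IsSquare (p ^ 2 - q ^ 2 * k) := by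
  obtain ⟨z, rfl⟩ := h
  obtain ⟨u, v, hz⟩ := exists_eq_add_mul_sqrt hs z.2
  obtain ⟨rfl, rfl⟩ : p = u ^ 2 + v ^ 2 * k ∧ q = 2 * u * v := by
    apply eq_of_add_mul_sqrt_eq hs hk
    rw [← hx, MulMemClass.coe_mul, hz]
    simp only [map_add, map_mul, map_pow, map_ofNat, ← hs]
    ring
  exact ⟨u ^ 2 - v ^ 2 * k, by ring⟩

theorem isSquare_or_isSquare_mul_of_isSquare (h2 : (2 : F) ≠ 0)
    (hs : s ^ 2 = algebraMap F E k) (hk : ¬ IsSquare k)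
    {m : F} (h : IsSquare (algebraMap F F⟮s⟯ m)) : IsSquare m ∨ IsSquare (m * k) := by
  obtain ⟨z, hz⟩ := h
  obtain ⟨u, v, huv⟩ := exists_eq_add_mul_sqrt hs z.2
  obtain ⟨rfl, h0⟩ : m = u ^ 2 + v ^ 2 * k ∧ 0 = 2 * u * v := by
    apply eq_of_add_mul_sqrt_eq hs hk
    have hz' : algebraMap F E m = (z : E) * z := congrArg Subtype.val hz
    rw [map_zero, zero_mul, add_zero, hz', huv]
    simp only [map_add, map_mul, map_pow, map_ofNat, ← hs]
    ring
  obtain rfl | rfl : u = 0 ∨ v = 0 := by simpa [h2] using h0.symm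
  · exact .inr ⟨v * k, by ring⟩
  · exact .inl ⟨u, by ring⟩

/-- A quadratic extension of a quadratic extension whose relative discriminant has norm `N` has a
Galois closure of degree `8` when `D`, `N` and `N * D` are not squares. -/
theorem finrank_eq_eight {D N p q : F} {a b c : E} (h2 : (2 : F) ≠ 0)
    (hD : ¬ IsSquare D) (hN : ¬ IsSquare N) (hND : ¬ IsSquare (N * D))
    (ha : a ^ 2 = algebraMap F E D) (hb : b ^ 2 = algebraMap F E p + algebraMap F E q * a)
    (hbc : (b * c) ^ 2 = algebraMap F E N) (hpq : p ^ 2 - q ^ 2 * D = N)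
    (htop : Algebra.adjoin F {a, b, c} = ⊤) : Module.finrank F E = 8 := by
  have hN0 : N ≠ 0 := fun h => hN (h ▸ IsSquare.zero)
  have hb0 : b ≠ 0 := by
    rintro rfl
    exact hN0 (by simpa using hbc.symm)
  have haK : a ∈ F⟮a⟯ := mem_adjoin_simple_self F a
  have hd : (b * c) ^ 2 = algebraMap F⟮a⟯ E (algebraMap F F⟮a⟯ N) := hbc
  have hdN : ¬ IsSquare (algebraMap F F⟮a⟯ N) := fun h =>
    (isSquare_or_isSquare_mul_of_isSquare h2 ha hD h).elim hN hND
  let e : F⟮a⟯ := algebraMap F F⟮a⟯ p + algebraMap F F⟮a⟯ q * ⟨a, haK⟩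
  have he : b ^ 2 = algebraMap F⟮a⟯⟮b * c⟯ E (algebraMap F⟮a⟯ F⟮a⟯⟮b * c⟯ e) := hb
  have heN : ¬ IsSquare (algebraMap F⟮a⟯ F⟮a⟯⟮b * c⟯ e) := by
    intro h
    have h2' : (2 : F⟮a⟯) ≠ 0 := by
      rw [← map_ofNat (algebraMap F F⟮a⟯)]
      simpa using h2
    rcases isSquare_or_isSquare_mul_of_isSquare h2' hd hdN h with h | h
    · exact hN (hpq ▸ isSquare_norm_of_isSquare ha hD (p := p) (q := q) rfl h)
    · have := isSquare_norm_of_isSquare ha hD (p := p * N) (q := q * N)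
        (by
          change (algebraMap F E p + algebraMap F E q * a) * algebraMap F E N = _
          simp only [map_mul]
          ring) h
      obtain ⟨w, hw⟩ := this
      refine hN ⟨w / N, ?_⟩
      field_simp
      linear_combination hw - N ^ 2 * hpq
  have hK : F⟮a⟯⟮b * c⟯⟮b⟯ = ⊤ := by
    rw [eq_top_iff]
    have hbL : b ∈ F⟮a⟯⟮b * c⟯⟮b⟯ := mem_adjoin_simple_self _ b
    have hdL : b * c ∈ F⟮a⟯⟮b * c⟯⟮b⟯ :=
      IntermediateField.algebraMap_mem F⟮a⟯⟮b * c⟯⟮b⟯ (⟨b * c, mem_adjoin_simple_self _ _⟩ : F⟮a⟯⟮b * c⟯)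
    have haL : a ∈ F⟮a⟯⟮b * c⟯⟮b⟯ :=
      IntermediateField.algebraMap_mem F⟮a⟯⟮b * c⟯⟮b⟯ (algebraMap F⟮a⟯ F⟮a⟯⟮b * c⟯ ⟨a, haK⟩)
    have hcL : c ∈ F⟮a⟯⟮b * c⟯⟮b⟯ := by
      simpa [hb0] using mul_mem (inv_mem hbL) hdL
    have : IsScalarTower F F⟮a⟯⟮b * c⟯ E := .of_algebraMap_eq fun _ => rfl
    have hle : Algebra.adjoin F {a, b, c} ≤
        F⟮a⟯⟮b * c⟯⟮b⟯.toSubalgebra.restrictScalars F := by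
      refine Algebra.adjoin_le ?_
      rintro x (rfl | rfl | rfl)
      exacts [haL, hbL, hcL]
    rw [htop] at hle
    exact fun x _ => hle (Algebra.mem_top (R := F) (x := x))
  rw [← Module.finrank_mul_finrank F F⟮a⟯ E, ← Module.finrank_mul_finrank F⟮a⟯ F⟮a⟯⟮b * c⟯ E,
    finrank_adjoin_sqrt ha hD, finrank_adjoin_sqrt hd hdN, ← finrank_top', ← hK,
    finrank_adjoin_sqrt he heN]

end Quadratic

section Arithmetic

theorem Int.not_isSquare_of_lt_of_lt {n m : ℤ} (hm : 0 ≤ m) (h₁ : m ^ 2 < n)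
    (h₂ : n < (m + 1) ^ 2) : ¬ IsSquare n := by
  rintro ⟨r, rfl⟩
  rw [← sq] at h₁ h₂
  have h₁' := sq_lt_sq.1 h₁
  have h₂' := sq_lt_sq.1 h₂
  rw [abs_of_nonneg hm] at h₁'
  rw [abs_of_nonneg (by lia : 0 ≤ m + 1)] at h₂'
  lia

variable {t : ℤ}

theorem not_isSquare_sq_sub_four (ht : 4 ≤ t) : ¬ IsSquare (t ^ 2 - 4) :=
  Int.not_isSquare_of_lt_of_lt (m := t - 1) (by lia) (by nlinarith) (by nlinarith)

theorem not_isSquare_four_mul_sq_add_nine (ht : 4 ≤ t) : ¬ IsSquare (4 * t ^ 2 + 9) :=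
  Int.not_isSquare_of_lt_of_lt (m := 2 * t) (by lia) (by nlinarith) (by nlinarith)

theorem not_isSquare_four_mul_sq_add_nine_mul (ht : 4 ≤ t) :
    ¬ IsSquare ((4 * t ^ 2 + 9) * (t ^ 2 - 4)) := by
  obtain h | h := lt_or_ge t 7
  · interval_cases t
    · exact Int.not_isSquare_of_lt_of_lt (m := 29) (by norm_num) (by norm_num) (by norm_num)
    · exact Int.not_isSquare_of_lt_of_lt (m := 47) (by norm_num) (by norm_num) (by norm_num)
    · exact Int.not_isSquare_of_lt_of_lt (m := 69) (by norm_num) (by norm_num) (by norm_num)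
  · exact Int.not_isSquare_of_lt_of_lt (m := 2 * t ^ 2 - 2)
      (by nlinarith) (by nlinarith) (by nlinarith)

end Arithmetic

section Splitting

variable {L : Type*} [Field L] {f : L[X]} {t : L}

theorem exists_roots_of_splits (hf : f = X ^ 4 - C t * X ^ 3 - X ^ 2 + C t * X + 1)
    (hs : f.Splits) :
    ∃ y z x w : L, y + z = t ∧ y * z = 1 ∧ x ^ 2 = y * x + 1 ∧ w ^ 2 = z * w + 1 := by
  have hdeg : f.degree = 4 := by
    rw [hf]
    compute_degree!
  obtain ⟨x, hx⟩ := hs.exists_eval_eq_zero (by simp [hdeg])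
  have hx' : x ^ 4 - t * x ^ 3 - x ^ 2 + t * x + 1 = 0 := by simpa [hf] using hx
  have hx0 : x ≠ 0 := by
    rintro rfl
    simp at hx'
  obtain ⟨y, hyx⟩ : ∃ y, x ^ 2 = y * x + 1 := ⟨x - x⁻¹, by field_simp; ring⟩
  obtain ⟨z, rfl⟩ : ∃ z, y + z = t := ⟨t - y, by ring⟩
  have hyz : y * z = 1 := by
    refine mul_left_cancel₀ (pow_ne_zero 2 hx0) ?_
    linear_combination -hx' + (x ^ 2 - x * z - 1) * hyx
  have hfac : f = (X ^ 2 - C y * X - 1) * (X ^ 2 - C z * X - 1) := by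
    have h := congrArg C hyz
    rw [map_mul, map_one] at h
    rw [hf, map_add]
    linear_combination -X ^ 2 * h
  have hdeg' : (X ^ 2 - C z * X - 1 : L[X]).degree = 2 := by compute_degree!
  have hf0 : f ≠ 0 := fun h => by simp [h] at hdeg
  obtain ⟨w, hw⟩ := (hs.of_dvd hf0 (hfac ▸ dvd_mul_left _ _)).exists_eval_eq_zero
    (by rw [hdeg']; exact two_ne_zero)
  refine ⟨y, z, x, w, rfl, hyz, hyx, ?_⟩
  simp only [eval_sub, eval_pow, eval_X, eval_mul, eval_C, eval_one] at hw
  linear_combination hw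

theorem eq_or_eq_of_quartic_eq_zero {y z x w r : L} (hyzt : y + z = t) (hyz : y * z = 1)
    (hx : x ^ 2 = y * x + 1) (hw : w ^ 2 = z * w + 1)
    (hr : r ^ 4 - t * r ^ 3 - r ^ 2 + t * r + 1 = 0) :
    r = x ∨ r = y - x ∨ r = w ∨ r = z - w := by
  have h : (r - x) * ((r - (y - x)) * ((r - w) * (r - (z - w)))) = 0 := by
    linear_combination hr + (r ^ 3 - r) * hyzt.symm + r ^ 2 * hyz
      - hx * (r ^ 2 - z * r + z * w - w ^ 2) - hw * (r ^ 2 - y * r - 1)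
  simpa [sub_eq_zero] using h

end Splitting

theorem Polynomial.natCard_gal_eq_finrank {F : Type*} [Field F] [PerfectField F] (p : F[X]) :
    Nat.card p.Gal = Module.finrank F p.SplittingField :=
  have : IsGalois F p.SplittingField := ⟨⟩
  IsGalois.card_aut_eq_finrank F p.SplittingField

theorem finrank_eq_eight_of_isSplittingField {t : ℤ} (ht : 4 ≤ t) {f : ℚ[X]}
    (hf : f = X ^ 4 - C (t : ℚ) * X ^ 3 - X ^ 2 + C (t : ℚ) * X + 1)
    (L : Type*) [Field L] [Algebra ℚ L] [IsSplittingField ℚ L f] : Module.finrank ℚ L = 8 := by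
  have : CharZero L := algebraRat.charZero L
  obtain ⟨y, z, x, w, hyzt, hyz, hx, hw⟩ := exists_roots_of_splits
    (t := (t : L)) (by simp [hf]) (IsSplittingField.splits L f)
  refine finrank_eq_eight (D := (t : ℚ) ^ 2 - 4) (N := 4 * (t : ℚ) ^ 2 + 9)
    (p := (t : ℚ) ^ 2 / 2 + 3) (q := (t : ℚ) / 2)
    (a := y - z) (b := 2 * x - y) (c := 2 * w - z)
    two_ne_zero ?_ ?_ ?_ ?_ ?_ ?_ (by ring) ?_
  · exact_mod_cast mt Rat.isSquare_intCast_iff.1 (not_isSquare_sq_sub_four ht)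
  · exact_mod_cast mt Rat.isSquare_intCast_iff.1 (not_isSquare_four_mul_sq_add_nine ht)
  · exact_mod_cast mt Rat.isSquare_intCast_iff.1 (not_isSquare_four_mul_sq_add_nine_mul ht)
  · simp only [map_sub, map_pow, map_intCast, map_ofNat, ← hyzt]
    linear_combination -4 * hyz
  · simp only [map_add, map_div₀, map_pow, map_intCast, map_ofNat, ← hyzt]
    linear_combination 4 * hx - hyz
  · simp only [map_add, map_mul, map_pow, map_intCast, map_ofNat, ← hyzt]
    linear_combination 4 * (2 * w - z) ^ 2 * hx + 4 * (y ^ 2 + 4) * hw + (y * z - 7) * hyz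
  · rw [eq_top_iff, ← IsSplittingField.adjoin_rootSet L f]
    refine Algebra.adjoin_le fun r hr => ?_
    have hr' : r ^ 4 - t * r ^ 3 - r ^ 2 + t * r + 1 = 0 := by
      simpa [hf] using (mem_rootSet.1 hr).2
    set A := Algebra.adjoin ℚ {y - z, 2 * x - y, 2 * w - z}
    have ha : y - z ∈ A := Algebra.subset_adjoin (by simp)
    have hb : 2 * x - y ∈ A := Algebra.subset_adjoin (by simp)
    have hc : 2 * w - z ∈ A := Algebra.subset_adjoin (by simp)
    have ht : y + z ∈ A := hyzt ▸ intCast_mem A t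
    have half : ∀ u : L, 2 * u ∈ A → u ∈ A := fun u hu => by
      simpa [Algebra.smul_def] using A.smul_mem hu (1 / 2 : ℚ)
    have hy : y ∈ A := half y (by convert add_mem ht ha using 1; ring)
    have hz : z ∈ A := by simpa using sub_mem ht hy
    have hxA : x ∈ A := half x (by simpa using add_mem hb hy)
    have hwA : w ∈ A := half w (by simpa using add_mem hc hz)
    obtain rfl | rfl | rfl | rfl := eq_or_eq_of_quartic_eq_zero hyzt hyz hx hw hr'
    exacts [hxA, sub_mem hy hxA, hwA, sub_mem hz hwA]

/-- For every integer `t ≥ 4`, the Galois group of the splitting field of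
`f(x;t) = x⁴ − t·x³ − x² + t·x + 1` over `ℚ` is isomorphic to the dihedral
group `D₄` of order 8. -/
theorem stmt_8 (t : ℤ) (ht : 4 ≤ t) :
    Nonempty
      ((X ^ 4 - C (t : ℚ) * X ^ 3 - X ^ 2 + C (t : ℚ) * X + 1 : Polynomial ℚ).Gal ≃*
        DihedralGroup 4) := by
  set f : ℚ[X] := X ^ 4 - C (t : ℚ) * X ^ 3 - X ^ 2 + C (t : ℚ) * X + 1 with hf
  have : Fact ((f.map (algebraMap ℚ f.SplittingField)).Splits) := ⟨SplittingField.splits f⟩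
  have hdeg : f.natDegree = 4 := by
    rw [hf]
    compute_degree!
  refine nonempty_mulEquiv_dihedralGroup_four (hdeg ▸ ncard_rootSet_le f f.SplittingField)
    (Gal.galActionHom f f.SplittingField) (Gal.galActionHom_injective f f.SplittingField) ?_
  exact f.natCard_gal_eq_finrank.trans
    (@finrank_eq_eight_of_isSplittingField t ht f hf _ _ _ (IsSplittingField.splittingField f))
end

section
/- For every integer t ≥ 7 and any root α of h(x;t) = x⁴ − t·x³ − 3x² + t·x + 1, the elements α, 1 − α, and 1 + α are all units in the ring of integers of ℚ(α); in particular both α and α² are exceptional units. -/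
open Polynomial NumberField

/-- For every integer `t ≥ 7` and any root `α` of
`h(x;t) = x⁴ − t·x³ − 3x² + t·x + 1`, the elements `α`, `1 − α` and `1 + α`
are all units in the ring of integers of `ℚ(α)`; in particular both `α` and
`α²` are exceptional units (`α²` and `1 − α²` are units as well). -/
theorem stmt_10 (t : ℤ) (ht : 7 ≤ t) (K : Type*) [Field K] [NumberField K] (α : K)
    (hα : Polynomial.aeval α
      (X ^ 4 - C (t : ℚ) * X ^ 3 - 3 * X ^ 2 + C (t : ℚ) * X + 1 : Polynomial ℚ) = 0)
    (hgen : IntermediateField.adjoin ℚ {α} = ⊤) :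
    (∃ u : (𝓞 K)ˣ, ((u : 𝓞 K) : K) = α) ∧
    (∃ v : (𝓞 K)ˣ, ((v : 𝓞 K) : K) = 1 - α) ∧
    (∃ w : (𝓞 K)ˣ, ((w : 𝓞 K) : K) = 1 + α) ∧
    (∃ u₂ : (𝓞 K)ˣ, ((u₂ : 𝓞 K) : K) = α ^ 2) ∧
    (∃ v₂ : (𝓞 K)ˣ, ((v₂ : 𝓞 K) : K) = 1 - α ^ 2) := by
  have h : α ^ 4 - (t : K) * α ^ 3 - 3 * α ^ 2 + (t : K) * α + 1 = 0 := by
    simpa [map_ofNat] using hα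
  have hint : IsIntegral ℤ α := by
    refine ⟨X ^ 4 - C t * X ^ 3 - 3 * X ^ 2 + C t * X + 1, by monicity!, ?_⟩
    simpa [eval₂_ofNat, -eq_intCast, -map_intCast, eq_intCast (Int.castRingHom K)] using h
  obtain ⟨a, rfl⟩ : ∃ a : 𝓞 K, (a : K) = α := ⟨⟨α, hint⟩, rfl⟩
  have ha : a ^ 4 - (t : 𝓞 K) * a ^ 3 - 3 * a ^ 2 + (t : 𝓞 K) * a + 1 = 0 := by
    apply RingOfIntegers.ext
    simpa [map_ofNat] using h
  have hu : IsUnit a :=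
    IsUnit.of_mul_eq_one (-(a ^ 3 - t * a ^ 2 - 3 * a + t)) (by linear_combination -ha)
  have hv : IsUnit (1 - a) :=
    IsUnit.of_mul_eq_one (-((1 + a) * (a ^ 2 - t * a - 2))) (by linear_combination ha)
  have hw : IsUnit (1 + a) :=
    IsUnit.of_mul_eq_one (-((1 - a) * (a ^ 2 - t * a - 2))) (by linear_combination ha)
  have hv₂ : IsUnit (1 - a ^ 2) := by
    rw [show 1 - a ^ 2 = (1 - a) * (1 + a) by ring]
    exact hv.mul hw
  exact ⟨⟨hu.unit, by simp⟩, ⟨hv.unit, by simp⟩, ⟨hw.unit, by simp⟩,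
    ⟨(hu.pow 2).unit, by simp⟩, ⟨hv₂.unit, by simp⟩⟩
end

section
/- For every integer t ≥ 7 and any root α of h(x;t) = x⁴ − t·x³ − 3x² + t·x + 1, the integer t² + 4 is a square in ℚ(α); consequently the quartic field ℚ(α) contains the real quadratic field ℚ(√(t² + 4)). -/
open Polynomial

/-- For every integer `t ≥ 7` and any root `α` of
`h(x;t) = x⁴ − t·x³ − 3x² + t·x + 1`, the integer `t² + 4` is a square in
`ℚ(α)`; consequently the quartic field `ℚ(α)` contains the real quadratic
field `ℚ(√(t² + 4))`. -/
theorem stmt_11 (t : ℤ) (ht : 7 ≤ t) (K : Type*) [Field K] [NumberField K] (α : K)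
    (hα : Polynomial.aeval α
      (X ^ 4 - C (t : ℚ) * X ^ 3 - 3 * X ^ 2 + C (t : ℚ) * X + 1 : Polynomial ℚ) = 0)
    (hgen : IntermediateField.adjoin ℚ {α} = ⊤) :
    ∃ γ : K, γ ^ 2 = (t : K) ^ 2 + 4 := by
  have hroot : α ^ 4 - (t : K) * α ^ 3 - 3 * α ^ 2 + (t : K) * α + 1 = 0 := by
    have h3 : aeval α (3 : ℚ[X]) = 3 := map_ofNat (aeval α) 3
    simpa [h3] using hα
  have hne : α ≠ 0 := by
    rintro rfl
    simp at hroot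
  refine ⟨2 * (α - α⁻¹) - t, ?_⟩
  field_simp
  linear_combination 4 * hroot
end

section
/- For every integer t ≥ 7, the Galois group of the splitting field of h(x;t) = x⁴ − t·x³ − 3x² + t·x + 1 over ℚ is isomorphic to the dihedral group D₄ of order 8. -/
open Polynomial

/-- Elements `ρ`, `τ` of a group satisfying the relations of the dihedral group of order `2 * n`
define a homomorphism from that group. -/
theorem DihedralGroup.exists_monoidHom {G : Type*} [Group G] {n : ℕ} [NeZero n] {ρ τ : G}
    (hρ : ρ ^ n = 1) (hτ : τ * τ = 1) (h : τ * ρ = ρ⁻¹ * τ) :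
    ∃ φ : DihedralGroup n →* G,
      (∀ i, φ (.r i) = ρ ^ i.val) ∧ ∀ i, φ (.sr i) = τ * ρ ^ i.val := by
  have h_add (i j : ZMod n) : ρ ^ (i + j).val = ρ ^ i.val * ρ ^ j.val := by
    rw [ZMod.val_add, ← pow_eq_pow_mod _ hρ, pow_add]
  have h_sub (i j : ZMod n) : ρ ^ (j - i).val = (ρ ^ i.val)⁻¹ * ρ ^ j.val := by
    rw [eq_inv_mul_iff_mul_eq, ← h_add, add_sub_cancel]
  have h_comm (k : ℕ) : ρ ^ k * τ = τ * (ρ ^ k)⁻¹ := by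
    have := (show SemiconjBy τ ρ ρ⁻¹ from h).pow_right k
    rw [eq_mul_inv_iff_mul_eq, mul_assoc, this.eq, inv_pow, mul_inv_cancel_left]
  refine ⟨MonoidHom.mk' (fun
    | .r i => ρ ^ i.val
    | .sr i => τ * ρ ^ i.val) ?_, fun _ => rfl, fun _ => rfl⟩
  rintro (i | i) (j | j)
  · exact h_add i j
  · change τ * ρ ^ (j - i).val = ρ ^ i.val * (τ * ρ ^ j.val)
    rw [h_sub, ← mul_assoc, ← h_comm, mul_assoc]
  · change τ * ρ ^ (i + j).val = τ * ρ ^ i.val * ρ ^ j.val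
    rw [h_add, mul_assoc]
  · change ρ ^ (j - i).val = τ * ρ ^ i.val * (τ * ρ ^ j.val)
    rw [h_sub, mul_assoc, ← mul_assoc (ρ ^ i.val), h_comm, mul_assoc, ← mul_assoc τ, hτ, one_mul]

section SignedPairs

variable {F K : Type*} [Field F] [Field K] [Algebra F K]

/-- If the automorphisms of `K` over `F` are determined by their values at `u` and `v`, each of them
acts on `{u, -u, v, -v}` as a symmetry of the square, and these symmetries include a rotation and a
reflection, then the automorphism group is dihedral of order 8. -/
theorem nonempty_algEquiv_mulEquiv_dihedralGroup_four {u v : K} (hu : u ≠ -u) (hv : v ≠ -v)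
    (huv : u ^ 2 ≠ v ^ 2)
    (h_ext : ∀ σ τ : K ≃ₐ[F] K, σ u = τ u → σ v = τ v → σ = τ)
    (h_range : ∀ σ : K ≃ₐ[F] K, ((σ u = u ∨ σ u = -u) ∧ (σ v = v ∨ σ v = -v)) ∨
      ((σ u = v ∨ σ u = -v) ∧ (σ v = u ∨ σ v = -u)))
    {ρ τ : K ≃ₐ[F] K} (hρu : ρ u = v) (hρv : ρ v = -u) (hτu : τ u = u) (hτv : τ v = -v) :
    Nonempty ((K ≃ₐ[F] K) ≃* DihedralGroup 4) := by
  have huv₁ : u ≠ v := by rintro rfl; exact huv rfl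
  have huv₂ : u ≠ -v := by rintro rfl; exact huv (neg_sq v)
  obtain ⟨φ, hφr, hφs⟩ := DihedralGroup.exists_monoidHom (n := 4) (ρ := ρ) (τ := τ)
    (h_ext _ _ (by simp [pow_succ, hρu, hρv]) (by simp [pow_succ, hρu, hρv]))
    (h_ext _ _ (by simp [hτu]) (by simp [hτv]))
    (by
      rw [eq_inv_mul_iff_mul_eq]
      exact h_ext _ _ (by simp [hρu, hρv, hτu, hτv]) (by simp [hρu, hρv, hτu, hτv]))
  have v1 : (1 : ZMod 4).val = 1 := rfl
  have v2 : (2 : ZMod 4).val = 2 := rfl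
  have v3 : (3 : ZMod 4).val = 3 := rfl
  refine ⟨(MulEquiv.ofBijective φ ⟨?_, fun σ => ?_⟩).symm⟩
  · rw [injective_iff_map_eq_one]
    rintro (i | i) hi
    · have := DFunLike.congr_fun hi u
      rw [hφr] at this
      fin_cases i
      · rfl
      · change (ρ ^ 1) u = _ at this
        simp [hρu, huv₁.symm] at this
      · change (ρ ^ 2) u = _ at this
        simp [pow_succ, hρu, hρv, hu.symm] at this
      · change (ρ ^ 3) u = _ at this
        simp [pow_succ, hρu, hρv, huv₂.symm] at this
    · have h₁ := DFunLike.congr_fun hi u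
      have h₂ := DFunLike.congr_fun hi v
      rw [hφs] at h₁ h₂
      exfalso
      fin_cases i
      · change (τ * ρ ^ 0) v = _ at h₂
        simp [hτv, hv.symm] at h₂
      · change (τ * ρ ^ 1) u = _ at h₁
        simp [hρu, hτv, huv₂.symm] at h₁
      · change (τ * ρ ^ 2) u = _ at h₁
        simp [pow_succ, hρu, hρv, hτu, hu.symm] at h₁
      · change (τ * ρ ^ 3) u = _ at h₁
        simp [pow_succ, hρu, hρv, hτv, huv₁.symm] at h₁
  · rcases h_range σ with ⟨h₁ | h₁, h₂ | h₂⟩ | ⟨h₁ | h₁, h₂ | h₂⟩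
    · exact ⟨.r 0, h_ext _ _ (by simp [h₁]) (by simp [h₂])⟩
    · refine ⟨.sr 0, h_ext _ _ ?_ ?_⟩ <;> simp [hφs, h₁, h₂, hτu, hτv]
    · refine ⟨.sr 2, h_ext _ _ ?_ ?_⟩ <;>
        simp [hφs, v2, pow_succ, h₁, h₂, hτu, hτv, hρu, hρv]
    · refine ⟨.r 2, h_ext _ _ ?_ ?_⟩ <;> simp [hφr, v2, pow_succ, h₁, h₂, hρu, hρv]
    · refine ⟨.sr 3, h_ext _ _ ?_ ?_⟩ <;>
        simp [hφs, v3, pow_succ, h₁, h₂, hτu, hτv, hρu, hρv]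
    · refine ⟨.r 1, h_ext _ _ ?_ ?_⟩ <;> simp [hφr, v1, h₁, h₂, hρu, hρv]
    · refine ⟨.r 3, h_ext _ _ ?_ ?_⟩ <;> simp [hφr, v3, pow_succ, h₁, h₂, hρu, hρv]
    · refine ⟨.sr 1, h_ext _ _ ?_ ?_⟩ <;>
        simp [hφs, v1, h₁, h₂, hτu, hτv, hρu, hρv]

theorem AlgEquiv.apply_eq_or_eq_neg_of_sq {z : K} {c : F} (hz : z ^ 2 = algebraMap F K c)
    (σ : K ≃ₐ[F] K) : σ z = z ∨ σ z = -z :=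
  sq_eq_sq_iff_eq_or_eq_neg.mp (by rw [← map_pow, hz, AlgEquiv.commutes])

/-- In a Galois extension, a square root of an element of the base field which is not a square
there is moved by some automorphism. -/
theorem IsGalois.exists_algEquiv_apply_ne [FiniteDimensional F K] [IsGalois F K] {x : K} {c : F}
    (hc : ¬ IsSquare c) (hx : x ^ 2 = algebraMap F K c) : ∃ σ : K ≃ₐ[F] K, σ x ≠ x := by
  by_contra! h
  obtain ⟨y, rfl⟩ := (IsGalois.mem_range_algebraMap_iff_fixed x).mpr h
  exact hc ⟨y, (algebraMap F K).injective (by rw [← hx, map_mul, sq])⟩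

/-- Square roots `x`, `y` of `a`, `b` such that none of `a`, `b`, `a * b` is a square in the base
field are negated independently by automorphisms. -/
theorem IsGalois.exists_algEquiv_neg_neg_and_self_neg [FiniteDimensional F K] [IsGalois F K]
    {x y : K} {a b : F} (ha : ¬ IsSquare a) (hb : ¬ IsSquare b) (hab : ¬ IsSquare (a * b))
    (hx : x ^ 2 = algebraMap F K a) (hy : y ^ 2 = algebraMap F K b) :
    (∃ σ : K ≃ₐ[F] K, σ x = -x ∧ σ y = -y) ∧ ∃ σ : K ≃ₐ[F] K, σ x = x ∧ σ y = -y := by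
  obtain ⟨α, hα⟩ := exists_algEquiv_apply_ne ha hx
  obtain ⟨β, hβ⟩ := exists_algEquiv_apply_ne hb hy
  obtain ⟨γ, hγ⟩ := exists_algEquiv_apply_ne hab
    (show (x * y) ^ 2 = algebraMap F K (a * b) by rw [mul_pow, hx, hy, map_mul])
  have hα' := (AlgEquiv.apply_eq_or_eq_neg_of_sq hx α).resolve_left hα
  have hβ' := (AlgEquiv.apply_eq_or_eq_neg_of_sq hy β).resolve_left hβ
  rw [map_mul] at hγ
  constructor
  · rcases AlgEquiv.apply_eq_or_eq_neg_of_sq hy α with h₁ | h₁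
    · rcases AlgEquiv.apply_eq_or_eq_neg_of_sq hx β with h₂ | h₂
      · exact ⟨α * β, by simp [hα', h₂], by simp [hβ', h₁]⟩
      · exact ⟨β, h₂, hβ'⟩
    · exact ⟨α, hα', h₁⟩
  · rcases AlgEquiv.apply_eq_or_eq_neg_of_sq hx β with h₁ | h₁
    · exact ⟨β, h₁, hβ'⟩
    · rcases AlgEquiv.apply_eq_or_eq_neg_of_sq hx γ with h₂ | h₂ <;>
        rcases AlgEquiv.apply_eq_or_eq_neg_of_sq hy γ with h₃ | h₃
      · simp [h₂, h₃] at hγ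
      · exact ⟨γ, h₂, h₃⟩
      · exact ⟨β * γ, by simp [h₁, h₂], by simp [hβ', h₃]⟩
      · simp [h₂, h₃] at hγ

end SignedPairs

theorem not_isSquare_sq_add_four {t : ℤ} (ht : 7 ≤ t) : ¬ IsSquare ((t : ℚ) ^ 2 + 4) := by
  rw [show (t : ℚ) ^ 2 + 4 = ((t ^ 2 + 4 : ℤ) : ℚ) by push_cast; rfl, Rat.isSquare_intCast_iff]
  rintro ⟨r, hr⟩
  have h₁ : t < |r| := lt_of_pow_lt_pow_left₀ 2 (abs_nonneg r) (by rw [sq_abs]; linarith)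
  have h₂ : |r| < t + 1 := lt_of_pow_lt_pow_left₀ 2 (by lia) (by rw [sq_abs]; linarith)
  lia

theorem not_isSquare_four_mul_sq_add {t : ℤ} (ht : 7 ≤ t) :
    ¬ IsSquare (4 * (t : ℚ) ^ 2 + 25) := by
  rw [show 4 * (t : ℚ) ^ 2 + 25 = ((4 * t ^ 2 + 25 : ℤ) : ℚ) by push_cast; rfl,
    Rat.isSquare_intCast_iff]
  rintro ⟨r, hr⟩
  have h₁ : 2 * t < |r| := lt_of_pow_lt_pow_left₀ 2 (abs_nonneg r) (by rw [sq_abs]; linarith)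
  have h₂ : |r| < 2 * t + 2 := lt_of_pow_lt_pow_left₀ 2 (by lia) (by rw [sq_abs]; linarith)
  have h₃ : |r| = 2 * t + 1 := by lia
  have h₄ : |r| ^ 2 = r * r := by rw [sq_abs, sq]
  rw [h₃] at h₄
  have h₅ : t = 6 := by linarith
  lia

theorem not_isSquare_mul {t : ℤ} (ht : 7 ≤ t) :
    ¬ IsSquare (((t : ℚ) ^ 2 + 4) * (4 * (t : ℚ) ^ 2 + 25)) := by
  rw [show ((t : ℚ) ^ 2 + 4) * (4 * (t : ℚ) ^ 2 + 25) =
    (((t ^ 2 + 4) * (4 * t ^ 2 + 25) : ℤ) : ℚ) by push_cast; rfl, Rat.isSquare_intCast_iff]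
  rintro ⟨r, hr⟩
  have h₀ : 0 < t ^ 2 := by positivity
  have h₁ : 2 * t ^ 2 + 10 < |r| :=
    lt_of_pow_lt_pow_left₀ 2 (abs_nonneg r) (by rw [sq_abs]; linarith)
  have h₂ : |r| < 2 * t ^ 2 + 11 :=
    lt_of_pow_lt_pow_left₀ 2 (by positivity) (by rw [sq_abs]; linarith)
  lia

/-- The automorphism group of a splitting field over `ℚ` of `X ^ 4 - t X ^ 3 - 3 X ^ 2 + t X + 1`
is dihedral of order 8 for all integers `t ≥ 7`. -/
theorem nonempty_mulEquiv_dihedralGroup_of_isSplittingField {t : ℤ} (ht : 7 ≤ t) (K : Type*)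
    [Field K] [Algebra ℚ K] {p : ℚ[X]} [IsSplittingField ℚ K p]
    (hp : p = X ^ 4 - C (t : ℚ) * X ^ 3 - 3 * X ^ 2 + C (t : ℚ) * X + 1) :
    Nonempty ((K ≃ₐ[ℚ] K) ≃* DihedralGroup 4) := by
  have hdeg : p.degree = 4 := by rw [hp]; compute_degree!
  have hp0 : p ≠ 0 := by rintro h; simp [h] at hdeg
  have h_splits : (p.map (algebraMap ℚ K)).Splits := IsSplittingField.splits K p
  have : FiniteDimensional ℚ K := IsSplittingField.finiteDimensional K p
  have : Normal ℚ K := Normal.of_isSplittingField p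
  have : IsGalois ℚ K := ⟨⟩
  have : CharZero K := algebraRat.charZero K
  have ht0 : (t : K) ≠ 0 := by exact_mod_cast (by lia : t ≠ 0)
  have h_map : p.map (algebraMap ℚ K) =
      X ^ 4 - C (t : K) * X ^ 3 - 3 * X ^ 2 + C (t : K) * X + 1 := by simp [hp]
  obtain ⟨a, ha⟩ := h_splits.exists_eval_eq_zero (by rw [degree_map, hdeg]; decide)
  have ha' : a ^ 4 - t * a ^ 3 - 3 * a ^ 2 + t * a + 1 = 0 := by simpa [h_map] using ha
  have ha0 : a ≠ 0 := by rintro rfl; simp at ha'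
  obtain ⟨y, hay⟩ : ∃ y, a ^ 2 - y * a - 1 = 0 := ⟨a - a⁻¹, by field_simp; ring⟩
  have hy : y ^ 2 - t * y - 1 = 0 := by
    refine (mul_eq_zero.mp ?_).resolve_right (pow_ne_zero 2 ha0)
    linear_combination ha' + (-a ^ 2 - a * y + 1 + t * a) * hay
  have h_factor : p.map (algebraMap ℚ K) =
      (X ^ 2 - C y * X - 1) * (X ^ 2 - C (t - y) * X - 1) := by
    have hC : (C y) ^ 2 - C (t : K) * C y - 1 = 0 := by
      rw [← C_pow, ← C_mul, ← C_sub, ← C_1, ← C_sub, hy, C_0]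
    rw [h_map, C_sub]
    linear_combination (X ^ 2) * hC
  obtain ⟨b, hb⟩ : ∃ b, eval b (X ^ 2 - C (t - y) * X - 1 : K[X]) = 0 := by
    refine Splits.exists_eval_eq_zero (h_splits.of_dvd (map_ne_zero hp0)
      (h_factor ▸ dvd_mul_left _ _)) ?_
    rw [show (X ^ 2 - C (t - y) * X - 1 : K[X]).degree = 2 by compute_degree!]
    decide
  simp only [eval_sub, eval_pow, eval_X, eval_mul, eval_C, eval_one] at hb
  obtain ⟨u, hua⟩ : ∃ u, u = 2 * a - y := ⟨_, rfl⟩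
  obtain ⟨v, hvb⟩ : ∃ v, v = 2 * b - (t - y) := ⟨_, rfl⟩
  have hu : u ^ 2 = y ^ 2 + 4 := by rw [hua]; linear_combination 4 * hay
  have hv : v ^ 2 = (t - y) ^ 2 + 4 := by rw [hvb]; linear_combination 4 * hb
  have hd : (2 * y - t) ^ 2 = algebraMap ℚ K (t ^ 2 + 4) := by
    simp only [map_add, map_pow, map_intCast, map_ofNat]
    linear_combination 4 * hy
  have hs : (u * v) ^ 2 = algebraMap ℚ K (4 * t ^ 2 + 25) := by
    simp only [map_add, map_mul, map_pow, map_intCast, map_ofNat]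
    rw [mul_pow, hu, hv]
    linear_combination (y ^ 2 - t * y + 9) * hy
  have h_sign (σ : K ≃ₐ[ℚ] K) := AlgEquiv.apply_eq_or_eq_neg_of_sq hd σ
  have h_two (σ : K ≃ₐ[ℚ] K) : σ 2 = 2 := map_ofNat σ 2
  have h_four (σ : K ≃ₐ[ℚ] K) : σ 4 = 4 := map_ofNat σ 4
  have hσd (σ : K ≃ₐ[ℚ] K) : σ (2 * y - t) = 2 * σ y - t := by simp [h_two]
  have hσ_self {σ : K ≃ₐ[ℚ] K} (h : σ (2 * y - t) = 2 * y - t) : σ y = y := by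
    rw [hσd] at h
    linear_combination (1 / 2) * h
  have hσ_neg {σ : K ≃ₐ[ℚ] K} (h : σ (2 * y - t) = -(2 * y - t)) : σ y = t - y := by
    rw [hσd] at h
    linear_combination (1 / 2) * h
  obtain ⟨⟨ρ, hρd, hρs⟩, τ, hτd, hτs⟩ := IsGalois.exists_algEquiv_neg_neg_and_self_neg
    (not_isSquare_sq_add_four ht) (not_isSquare_four_mul_sq_add ht) (not_isSquare_mul ht) hd hs
  have huv0 : u * v ≠ 0 := by
    intro h
    rw [h, zero_pow two_ne_zero, eq_comm, map_eq_zero] at hs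
    have : 0 < 4 * (t : ℚ) ^ 2 + 25 := by positivity
    exact this.ne' hs
  have hd0 : 2 * y - t ≠ 0 := by
    intro h
    rw [h, zero_pow two_ne_zero, eq_comm, map_eq_zero] at hd
    have : 0 < (t : ℚ) ^ 2 + 4 := by positivity
    exact this.ne' hd
  obtain ⟨w, hw⟩ : ∃ w, w = ρ u := ⟨_, rfl⟩
  have hw2 : w ^ 2 = (t - y) ^ 2 + 4 := by
    rw [hw, ← map_pow, hu, ← hσ_neg hρd]; simp [h_four]
  have hu0 : u ≠ 0 := left_ne_zero_of_mul huv0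
  have hw0 : w ≠ 0 := by rw [hw]; exact (map_ne_zero ρ).mpr hu0
  have hwv : w = v ∨ w = -v := sq_eq_sq_iff_eq_or_eq_neg.mp (hw2.trans hv.symm)
  have h_uw {σ : K ≃ₐ[ℚ] K} (h : σ (u * v) = -(u * v)) : σ u * σ w = -(u * w) := by
    rw [← map_mul]
    rcases hwv with rfl | rfl
    · exact h
    · rw [mul_neg, map_neg, h]
  have h_self {σ : K ≃ₐ[ℚ] K} (h : σ y = y) :
      (σ u = u ∨ σ u = -u) ∧ (σ w = w ∨ σ w = -w) := by
    constructor <;> refine sq_eq_sq_iff_eq_or_eq_neg.mp ?_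
    · rw [← map_pow, hu]; simp [h, h_four]
    · rw [← map_pow, hw2]; simp [h, h_four]
  have h_neg {σ : K ≃ₐ[ℚ] K} (h : σ y = t - y) :
      (σ u = w ∨ σ u = -w) ∧ (σ w = u ∨ σ w = -u) := by
    constructor <;> refine sq_eq_sq_iff_eq_or_eq_neg.mp ?_
    · rw [← map_pow, hu, hw2]; simp [h, h_four]
    · rw [← map_pow, hw2, hu]; simp [h, h_four]
  have hρw : ρ w = -u := by
    have := h_uw hρs
    rw [← hw] at this
    exact mul_left_cancel₀ hw0 (by rw [this]; ring)
  have hτy := hσ_self hτd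
  obtain ⟨τ', hτu, hτw⟩ : ∃ τ' : K ≃ₐ[ℚ] K, τ' u = u ∧ τ' w = -w := by
    have := h_uw hτs
    rcases (h_self hτy).1 with h | h
    · rw [h] at this
      exact ⟨τ, h, mul_left_cancel₀ hu0 (by rw [this]; ring)⟩
    · rw [h] at this
      have hw' : τ w = w := mul_left_cancel₀ hu0 (by linear_combination -this)
      exact ⟨ρ * ρ * τ, by simp [h, ← hw, hρw], by simp [hw', ← hw, hρw]⟩
  have huw : u ^ 2 - w ^ 2 = t * (2 * y - t) := by rw [hu, hw2]; ring
  refine nonempty_algEquiv_mulEquiv_dihedralGroup_four (F := ℚ) (K := K)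
    (self_ne_neg.mpr hu0) (self_ne_neg.mpr hw0)
    (fun h => mul_ne_zero ht0 hd0 (by rw [← huw, h, sub_self]))
    (fun σ σ' h₁ h₂ => ?_)
    (fun σ => (h_sign σ).imp (fun h => h_self (hσ_self h)) (fun h => h_neg (hσ_neg h)))
    hw.symm hρw hτu hτw
  have h_y : σ y = σ' y := by
    have h₃ : y = ((u ^ 2 - w ^ 2) / t + t) / 2 := by rw [huw]; field_simp; ring
    rw [h₃]
    simp [h₁, h₂, h_two]
  suffices (σ : K →ₐ[ℚ] K) = σ' from AlgEquiv.ext fun x => DFunLike.congr_fun this x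
  refine AlgHom.ext_of_adjoin_eq_top (IsSplittingField.adjoin_rootSet K p) fun x hx => ?_
  change σ x = σ' x
  have hx' : (x ^ 2 - y * x - 1) * (x ^ 2 - (t - y) * x - 1) = 0 := by
    have := (mem_rootSet.mp hx).2
    rw [aeval_def, ← eval_map, h_factor] at this
    simpa using this
  rcases mul_eq_zero.mp hx' with h | h
  · have : (2 * x - y) ^ 2 = u ^ 2 := by rw [hu]; linear_combination 4 * h
    rcases sq_eq_sq_iff_eq_or_eq_neg.mp this with h | h
    · rw [show x = (y + u) / 2 by linear_combination (1 / 2) * h]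
      simp [h₁, h_y, h_two]
    · rw [show x = (y - u) / 2 by linear_combination (1 / 2) * h]
      simp [h₁, h_y, h_two]
  · have : (2 * x - (t - y)) ^ 2 = w ^ 2 := by rw [hw2]; linear_combination 4 * h
    rcases sq_eq_sq_iff_eq_or_eq_neg.mp this with h | h
    · rw [show x = (t - y + w) / 2 by linear_combination (1 / 2) * h]
      simp [h₂, h_y, h_two]
    · rw [show x = (t - y - w) / 2 by linear_combination (1 / 2) * h]
      simp [h₂, h_y, h_two]

/-- For every integer `t ≥ 7`, the Galois group of the splitting field of
`h(x;t) = x⁴ − t·x³ − 3x² + t·x + 1` over `ℚ` is isomorphic to the dihedral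
group `D₄` of order 8. -/
theorem stmt_12 (t : ℤ) (ht : 7 ≤ t) :
    Nonempty
      ((X ^ 4 - C (t : ℚ) * X ^ 3 - 3 * X ^ 2 + C (t : ℚ) * X + 1 : Polynomial ℚ).Gal ≃*
        DihedralGroup 4) := by
  exact nonempty_mulEquiv_dihedralGroup_of_isSplittingField ht (SplittingField _) rfl
end

section
/- There exist infinitely many integers t ≥ 7 such that, for a root α of h(x;t) = x⁴ − t·x³ − 3x² + t·x + 1, the number field ℚ(α) is monogenic with power basis generated by α; that is, the ring of integers of ℚ(α) equals ℤ[α] = ℤ + αℤ + α²ℤ + α³ℤ. -/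
open Polynomial

/-- If an integral element `e` outside `F` is a root of a monic quadratic over `F`,
then the coefficients of this quadratic are integral. -/
lemma isIntegral_coeff_of_quadratic {F L : Type*} [Field F] [Field L] [Algebra F L] {e : L}
    (he : IsIntegral ℤ e) {a b : F}
    (h : e ^ 2 = algebraMap F L a * e + algebraMap F L b)
    (hn : e ∉ (algebraMap F L).range) : IsIntegral ℤ a ∧ IsIntegral ℤ b := by
  obtain ⟨f, hf, hfe⟩ := he
  set g : F[X] := X ^ 2 - C a * X - C b with hg
  have hdeg : g.natDegree = 2 := by rw [hg]; compute_degree!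
  have hgm : g.Monic := by rw [hg]; monicity!
  have hge : aeval e g = 0 := by simp [hg, h]
  have hei : IsIntegral F e := ⟨g, hgm, hge⟩
  have hmin : minpoly F e = g :=
    (Polynomial.eq_of_monic_of_dvd_of_natDegree_le (minpoly.monic hei) hgm (minpoly.dvd F e hge)
      (hdeg ▸ (minpoly.two_le_natDegree_iff hei).2 hn)).symm
  have hdvd : g ∣ f.map (algebraMap ℤ F) := by
    rw [← hmin]
    apply minpoly.dvd
    rw [aeval_map_algebraMap]
    exact hfe
  have hl := (lifts_iff_coeff_lifts _).1 (integralClosure.mem_lifts_of_monic_of_dvd_map F hf hgm hdvd)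
  have key : ∀ i, IsIntegral ℤ (g.coeff i) := fun i ↦ by
    obtain ⟨x, hx⟩ := hl i
    rw [← hx]
    exact x.2
  have h0 := key 0
  have h1 := key 1
  simp only [hg, coeff_sub, coeff_X_pow, coeff_C_mul, coeff_X, coeff_C] at h0 h1
  norm_num at h0 h1
  exact ⟨by simpa using h1.neg, by simpa using h0.neg⟩

lemma exists_int_of_isIntegral {q : ℚ} (h : IsIntegral ℤ q) : ∃ n : ℤ, q = n := by
  obtain ⟨n, hn⟩ := IsIntegrallyClosed.isIntegral_iff.1 h
  exact ⟨n, by simpa using hn.symm⟩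

lemma exists_int_of_mul_sq {d m : ℤ} (hd : Squarefree d) {q : ℚ} (h : q ^ 2 * d = m) :
    ∃ n : ℤ, q = n := by
  have h1 : q.num ^ 2 * d = m * (q.den : ℤ) ^ 2 := by
    have : (q.den : ℚ) ≠ 0 := by exact_mod_cast q.den_nz
    have h2 := h
    rw [← Rat.num_div_den q] at h2
    field_simp at h2
    have h3 : (q.num : ℚ) ^ 2 * d = m * (q.den : ℚ) ^ 2 := by rw [h2]; ring
    exact_mod_cast h3
  have hc : IsCoprime ((q.den : ℤ) ^ 2) (q.num ^ 2) :=
    (Rat.isCoprime_num_den q).symm.pow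
  have h2 : (q.den : ℤ) * q.den ∣ d := by
    rw [← sq]
    exact hc.dvd_of_dvd_mul_left (h1 ▸ Dvd.intro_left _ rfl)
  have h3 : q.den = 1 := by
    have := Int.isUnit_iff_natAbs_eq.1 (hd _ h2)
    simpa using this
  exact ⟨q.num, ((Rat.den_eq_one_iff q).1 h3).symm⟩

/-- Elements of an algebra generated by a root of `X ^ 2 - a X - b` are linear in the root. -/
lemma exists_linear_of_mem_adjoin {R A : Type*} [CommRing R] [CommRing A] [Algebra R A] {x z : A}
    {a b : R} (hx : x ^ 2 = algebraMap R A a * x + algebraMap R A b)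
    (hz : z ∈ Algebra.adjoin R {x}) :
    ∃ u v : R, z = algebraMap R A u + algebraMap R A v * x := by
  induction hz using Algebra.adjoin_induction with
  | mem x' h => exact ⟨0, 1, by simpa using h⟩
  | algebraMap r => exact ⟨r, 0, by simp⟩
  | add p q _ _ hp hq =>
    obtain ⟨u, v, rfl⟩ := hp
    obtain ⟨u', v', rfl⟩ := hq
    exact ⟨u + u', v + v', by simp only [map_add]; ring⟩
  | mul p q _ _ hp hq =>
    obtain ⟨u, v, rfl⟩ := hp
    obtain ⟨u', v', rfl⟩ := hq
    refine ⟨u * u' + v * v' * b, u * v' + v * u' + v * v' * a, ?_⟩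
    simp only [map_add, map_mul]
    linear_combination algebraMap R A v * algebraMap R A v' * hx

lemma isIntegral_of_sq_eq_s13 {A : Type*} [CommRing A] {x : A} (a b : ℤ) (hx : x ^ 2 = a * x + b) :
    IsIntegral ℤ x :=
  ⟨X ^ 2 - C a * X - C b, by monicity!, by rw [← aeval_def]; simp [hx]⟩

section Quadratic

variable {K : Type*} [Field K] [CharZero K] {t : ℤ} {y : K}

lemma not_rational_of_sq_eq (ht : t ≠ 0) (hy : y ^ 2 = t * y + 1) (q : ℚ) : y ≠ q := by
  rintro rfl
  have h : q ^ 2 = t * q + 1 := by exact_mod_cast hy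
  have hi : IsIntegral ℤ q := isIntegral_of_sq_eq_s13 t 1 (by simpa using h)
  obtain ⟨n, rfl⟩ := exists_int_of_isIntegral hi
  have h' : n * (n - t) = 1 := by
    have : n ^ 2 = t * n + 1 := by exact_mod_cast h
    linear_combination this
  rcases Int.eq_one_or_neg_one_of_mul_eq_one' h' with h | h <;> omega

lemma linear_injective (hy : ∀ q : ℚ, y ≠ q) {u v u' v' : ℚ}
    (h : (u + v * y : K) = u' + v' * y) : u = u' ∧ v = v' := by
  have hv : v = v' := by
    by_contra hne
    have h1 : (v - v' : K) ≠ 0 := by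
      rw [sub_ne_zero]; exact_mod_cast hne
    apply hy ((u' - u) / (v - v'))
    push_cast
    rw [eq_div_iff h1]
    linear_combination h
  subst hv
  exact ⟨by exact_mod_cast add_right_cancel h, rfl⟩

/-- If `t ^ 2 + 4` is squarefree, then the integral elements of `ℚ(y)` form `ℤ[y]`. -/
lemma exists_int_linear_of_isIntegral (ht : Squarefree (t ^ 2 + 4)) (hy : y ^ 2 = t * y + 1)
    {u v : ℚ} (hi : IsIntegral ℤ (u + v * y : K)) : (∃ m : ℤ, u = m) ∧ ∃ n : ℤ, v = n := by
  have ht0 : t ≠ 0 := by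
    rintro rfl
    have := ht 2 ⟨1, by norm_num⟩
    rw [Int.isUnit_iff] at this
    omega
  have hirr := not_rational_of_sq_eq ht0 hy
  by_cases hr : (u + v * y : K) ∈ (algebraMap ℚ K).range
  · obtain ⟨r, hr⟩ := hr
    obtain ⟨rfl, rfl⟩ := linear_injective hirr (u := u) (v := v) (u' := r) (v' := 0)
      (by rw [← hr]; simp)
    refine ⟨?_, 0, by simp⟩
    apply exists_int_of_isIntegral
    rw [← isIntegral_algebraMap_iff (algebraMap ℚ K).injective]
    simpa using hi
  · obtain ⟨h1, h2⟩ := isIntegral_coeff_of_quadratic hi (F := ℚ) (a := 2 * u + v * t)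
      (b := v ^ 2 - u * v * t - u ^ 2) (by
        simp only [eq_ratCast]; push_cast
        linear_combination (v : K) ^ 2 * hy) hr
    obtain ⟨p, hp⟩ := exists_int_of_isIntegral h1
    obtain ⟨q, hq⟩ := exists_int_of_isIntegral h2
    obtain ⟨n, rfl⟩ := exists_int_of_mul_sq ht (q := v) (m := p ^ 2 + 4 * q) (by
      push_cast; rw [← hp, ← hq]; ring)
    refine ⟨exists_int_of_isIntegral (isIntegral_of_sq_eq_s13 (-(n * t)) (n ^ 2 - q) ?_), n, rfl⟩
    push_cast
    rw [← hq]; ring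

/-- Since the norm `4 t ^ 2 + 25` of `t y + 5` is squarefree,
`b ^ 2 (t y + 5)` integral forces `b` integral. -/
lemma exists_int_linear_of_isIntegral_sq_mul (ht : Squarefree (t ^ 2 + 4))
    (ht' : Squarefree (4 * t ^ 2 + 25)) (hy : y ^ 2 = t * y + 1)
    {u v : ℚ} (hi : IsIntegral ℤ ((u + v * y) ^ 2 * (t * y + 5) : K)) :
    (∃ m : ℤ, u = m) ∧ ∃ n : ℤ, v = n := by
  have ht0 : t ≠ 0 := by
    rintro rfl
    have := ht 2 ⟨1, by norm_num⟩
    rw [Int.isUnit_iff] at this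
    omega
  have hirr := not_rational_of_sq_eq ht0 hy
  have hyi : IsIntegral ℤ y := isIntegral_of_sq_eq_s13 t 1 (by simpa using hy)
  have hti : IsIntegral ℤ (t : K) := isIntegral_algebraMap (R := ℤ) (x := t)
  have hwi : IsIntegral ℤ (t * y + 5 : K) :=
    (hti.mul hyi).add (by simpa using isIntegral_algebraMap (R := ℤ) (A := K) (x := 5))
  have hc : IsIntegral ℤ ((u + v * y) * (t * y + 5) : K) := by
    refine IsIntegral.of_pow (n := 2) two_pos ?_
    rw [show ((u + v * y) * (t * y + 5) : K) ^ 2 = (u + v * y) ^ 2 * (t * y + 5) * (t * y + 5) by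
      ring]
    exact hi.mul hwi
  obtain ⟨⟨m, hm⟩, n, hn⟩ := exists_int_linear_of_isIntegral ht hy
    (u := 5 * u + t * v) (v := t * u + 5 * v + t ^ 2 * v) (by
      convert hc using 1
      push_cast
      linear_combination (-(v : K) * t) * hy)
  obtain ⟨⟨m', hm'⟩, n', hn'⟩ := exists_int_linear_of_isIntegral ht hy
    (u := u * m + v * n) (v := u * n + v * m + t * v * n) (by
      have hmK : (m : K) = 5 * u + t * v := by rw [← Rat.cast_intCast, ← hm]; push_cast; ring
      have hnK : (n : K) = t * u + 5 * v + t ^ 2 * v := by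
        rw [← Rat.cast_intCast, ← hn]; push_cast; ring
      convert hi using 1; push_cast; rw [hmK, hnK]
      linear_combination -(v * (t * u + 5 * v + t ^ 2 * v) + (u + v * y) * t * v) * hy)
  -- the congruence `y ≡ -5 / t` modulo `t y + 5`
  have hl : (t * m - 5 * n) ^ 2 = (4 * t ^ 2 + 25) * (n ^ 2 - t * n') := by
    have : ((t * m - 5 * n) ^ 2 : ℚ) = (4 * t ^ 2 + 25) * (n ^ 2 - t * n') := by
      rw [← hn', ← hm, ← hn]; ring
    exact_mod_cast this
  obtain ⟨r, hr⟩ := (ht'.dvd_pow_iff_dvd two_ne_zero).1 ⟨_, hl⟩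
  have hD : (4 * t ^ 2 + 25 : ℚ) ≠ 0 := by positivity
  have hv : v = (-r : ℤ) := by
    have : (t * m - 5 * n : ℚ) = (4 * t ^ 2 + 25) * r := by exact_mod_cast hr
    rw [← hm, ← hn] at this
    push_cast
    apply mul_left_cancel₀ hD
    linear_combination -this
  refine ⟨?_, _, hv⟩
  have h5 : IsCoprime (5 : ℤ) t := by
    rw [Prime.coprime_iff_not_dvd (by norm_num)]
    rintro ⟨s, rfl⟩
    have := ht' 5 ⟨4 * s ^ 2 + 1, by ring⟩
    rw [Int.isUnit_iff] at this
    omega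
  obtain ⟨p, q, hpq⟩ := h5
  refine ⟨p * (m + t * r) + q * (n + 5 * r + t ^ 2 * r), ?_⟩
  have hpq' : (p * 5 + q * t : ℚ) = 1 := by exact_mod_cast hpq
  have hv' : v = -r := by simpa using hv
  push_cast
  rw [← hm, ← hn, hv']
  linear_combination -u * hpq'

end Quadratic

theorem integralClosure_eq_adjoin {t : ℤ} (ht : Squarefree (t ^ 2 + 4))
    (ht' : Squarefree (4 * t ^ 2 + 25)) {K : Type*} [Field K] [NumberField K] {α : K}
    (hα : α ^ 4 - t * α ^ 3 - 3 * α ^ 2 + t * α + 1 = 0)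
    (htop : IntermediateField.adjoin ℚ {α} = ⊤) :
    integralClosure ℤ K = Algebra.adjoin ℤ {α} := by
  have hα0 : α ≠ 0 := by rintro rfl; simp at hα
  have hαi : IsIntegral ℤ α :=
    ⟨X ^ 4 - C t * X ^ 3 - 3 * X ^ 2 + C t * X + 1, by monicity!, by
      rw [← aeval_def]; simpa [map_ofNat] using hα⟩
  apply le_antisymm _ (Algebra.adjoin_le (Set.singleton_subset_iff.2 hαi))
  intro z hz
  change IsIntegral ℤ z at hz
  obtain ⟨y, hyα⟩ : ∃ y, y = α + (α ^ 3 - t * α ^ 2 - 3 * α + t) := ⟨_, rfl⟩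
  have hα2 : α ^ 2 = y * α + 1 := by rw [hyα]; linear_combination -hα
  have hy : y ^ 2 = t * y + 1 := by
    have : y = α - α⁻¹ := by field_simp; linear_combination -hα2
    rw [this]; field_simp; linear_combination hα
  have hαmem : α ∈ Algebra.adjoin ℤ {α} := Algebra.self_mem_adjoin_singleton ℤ α
  have hint (n : ℤ) : (n : K) ∈ Algebra.adjoin ℤ {α} := by
    simp
  have hymem : y ∈ Algebra.adjoin ℤ {α} := by
    rw [hyα]
    have h3 := hint 3
    push_cast at h3
    exact add_mem hαmem (add_mem (sub_mem (sub_mem (pow_mem hαmem 3)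
      (mul_mem (hint t) (pow_mem hαmem 2))) (mul_mem h3 hαmem)) (hint t))
  have hk (x : IntermediateField.adjoin ℚ {y}) : ∃ u v : ℚ, (x : K) = u + v * y := by
    have hx : (x : K) ∈ (IntermediateField.adjoin ℚ {y}).toSubalgebra := x.2
    rw [IntermediateField.adjoin_simple_toSubalgebra_of_isAlgebraic
      (Algebra.IsAlgebraic.isAlgebraic y)] at hx
    simpa using exists_linear_of_mem_adjoin (a := (t : ℚ)) (b := 1) (by simpa using hy) hx
  have hkmem (x : IntermediateField.adjoin ℚ {y}) (hx : IsIntegral ℤ (x : K)) :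
      (x : K) ∈ Algebra.adjoin ℤ {α} := by
    obtain ⟨u, v, h⟩ := hk x
    rw [h] at hx ⊢
    obtain ⟨⟨m, rfl⟩, n, rfl⟩ := exists_int_linear_of_isIntegral ht hy hx
    simpa using add_mem (hint m) (mul_mem (hint n) hymem)
  let yk : IntermediateField.adjoin ℚ {y} := ⟨y, IntermediateField.mem_adjoin_simple_self ℚ y⟩
  obtain ⟨a, b, hab⟩ : ∃ a b : IntermediateField.adjoin ℚ {y}, z = a + b * α := by
    have hz' : z ∈ Algebra.adjoin (IntermediateField.adjoin ℚ {y}) {α} := by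
      have h1 : z ∈ (IntermediateField.adjoin ℚ {α}).toSubalgebra := by rw [htop]; trivial
      rw [IntermediateField.adjoin_simple_toSubalgebra_of_isAlgebraic
        (Algebra.IsAlgebraic.isAlgebraic α)] at h1
      have h2 : Algebra.adjoin ℚ {α} ≤
          (Algebra.adjoin (IntermediateField.adjoin ℚ {y}) {α}).restrictScalars ℚ :=
        Algebra.adjoin_le (by simp)
      exact h2 h1
    exact exists_linear_of_mem_adjoin (a := yk) (b := 1) (by simpa using hα2) hz'
  by_cases hzk : z ∈ (algebraMap (IntermediateField.adjoin ℚ {y}) K).range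
  · obtain ⟨x, rfl⟩ := hzk
    exact hkmem x hz
  obtain ⟨h1, h2⟩ := isIntegral_coeff_of_quadratic hz (a := 2 * a + b * yk)
    (b := b ^ 2 - a * b * yk - a ^ 2) (by
      simp only [map_add, map_sub, map_mul, map_pow, map_ofNat]
      change z ^ 2 = (2 * a + b * y : K) * z + (b ^ 2 - a * b * y - a ^ 2 : K)
      rw [hab]
      linear_combination (b : K) ^ 2 * hα2) hzk
  have h4 : IsIntegral ℤ (4 : IntermediateField.adjoin ℚ {y}) := by
    simpa using isIntegral_algebraMap (R := ℤ) (A := IntermediateField.adjoin ℚ {y}) (x := 4)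
  have h3 : IsIntegral ℤ ((2 * a + b * yk) ^ 2 + 4 * (b ^ 2 - a * b * yk - a ^ 2)) :=
    (h1.pow 2).add (h4.mul h2)
  obtain ⟨u, v, huv⟩ := hk b
  have h4 : IsIntegral ℤ ((u + v * y) ^ 2 * (t * y + 5) : K) := by
    have h5 := h3.map (Algebra.ofId (IntermediateField.adjoin ℚ {y}) K |>.restrictScalars ℤ)
    convert h5 using 1
    simp only [map_add, map_sub, map_mul, map_pow, map_ofNat]
    change _ = ((2 * a + b * y) ^ 2 + 4 * (b ^ 2 - a * b * y - a ^ 2) : K)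
    rw [← huv]
    linear_combination -(b : K) ^ 2 * hy
  obtain ⟨⟨m, rfl⟩, n, rfl⟩ := exists_int_linear_of_isIntegral_sq_mul ht ht' hy h4
  have hbmem : (b : K) ∈ Algebra.adjoin ℤ {α} := by
    rw [huv]
    simpa using add_mem (hint m) (mul_mem (hint n) hymem)
  have hbi : IsIntegral ℤ (b : K) :=
    Algebra.adjoin_le (S := integralClosure ℤ K) (Set.singleton_subset_iff.2 hαi) hbmem
  rw [hab]
  refine add_mem (hkmem a ?_) (mul_mem hbmem hαmem)
  have := hz.sub (hbi.mul hαi)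
  rwa [hab, add_sub_cancel_right] at this

/-- At most two integers in any interval of length `p ^ 2` satisfy
`p ^ 2 ∣ (a n + b) ^ 2 + c ^ 2`. -/
lemma card_sq_dvd_le {a b c p : ℕ} (hp : p.Prime) (h2 : ¬p ∣ 2) (ha : ¬p ∣ a) (hc : ¬p ∣ c)
    (N : ℕ) :
    ((Finset.range N).filter fun n ↦ p ^ 2 ∣ (a * n + b) ^ 2 + c ^ 2).card ≤
      2 * (N / p ^ 2 + 1) := by
  have hpi : Prime (p : ℤ) := Nat.prime_iff_prime_int.1 hp
  have inj (m n : ℕ) (hq : m / p ^ 2 = n / p ^ 2)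
      (h : (p : ℤ) ^ 2 ∣ (a * m + b) - (a * n + b)) : m = n := by
    have h1 : (p : ℤ) ^ 2 ∣ (m : ℤ) - n :=
      hpi.pow_dvd_of_dvd_mul_left 2 (a := (a : ℤ)) (by exact_mod_cast ha)
        (h.elim fun k hk ↦ ⟨k, by linear_combination hk⟩)
    have h3 : m % p ^ 2 = n % p ^ 2 :=
      ((Nat.modEq_iff_dvd (a := n) (b := m)).2 (by exact_mod_cast h1)).symm
    rw [← Nat.div_add_mod m (p ^ 2), ← Nat.div_add_mod n (p ^ 2), hq, h3]
  -- distinct solutions in the same interval have opposite values of `a n + b` modulo `p ^ 2`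
  have opp (m n : ℕ) (hm : p ^ 2 ∣ (a * m + b) ^ 2 + c ^ 2) (hn : p ^ 2 ∣ (a * n + b) ^ 2 + c ^ 2)
      (hq : m / p ^ 2 = n / p ^ 2) (hne : m ≠ n) :
      (p : ℤ) ^ 2 ∣ (a * m + b) + (a * n + b) := by
    have hm' : (p : ℤ) ^ 2 ∣ (a * m + b) ^ 2 + c ^ 2 := by exact_mod_cast hm
    have hn' : (p : ℤ) ^ 2 ∣ (a * n + b) ^ 2 + c ^ 2 := by exact_mod_cast hn
    have hmul : (p : ℤ) ^ 2 ∣ ((a * m + b) - (a * n + b)) * ((a * m + b) + (a * n + b)) :=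
      (dvd_sub hm' hn').elim fun k hk ↦ ⟨k, by linear_combination hk⟩
    refine hpi.pow_dvd_of_dvd_mul_left 2 (fun hsub ↦ ?_) hmul
    refine hne (inj m n hq (hpi.pow_dvd_of_dvd_mul_right 2 (fun hadd ↦ ?_) hmul))
    have h2A : (p : ℤ) ∣ 2 * (a * m + b) :=
      (dvd_add hsub hadd).elim fun k hk ↦ ⟨k, by linear_combination hk⟩
    have hA : (p : ℤ) ∣ a * m + b := (hpi.dvd_or_dvd h2A).resolve_left (by exact_mod_cast h2)
    have hcc : (p : ℤ) ∣ c ^ 2 :=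
      (dvd_add_right (dvd_pow hA two_ne_zero)).1 ((dvd_pow_self _ two_ne_zero).trans hm')
    exact hc (by exact_mod_cast hpi.dvd_of_dvd_pow hcc)
  calc _ ≤ 2 * (((Finset.range N).filter fun n ↦ p ^ 2 ∣ (a * n + b) ^ 2 + c ^ 2).image
        (· / p ^ 2)).card := by
        refine Finset.card_le_mul_card_image _ _ fun q _ ↦ ?_
        by_contra! h
        obtain ⟨x, hx, y, hy, z, hz, hxy, hxz, hyz⟩ := Finset.two_lt_card.1 h
        simp only [Finset.mem_filter] at hx hy hz
        have h1 := opp x y hx.1.2 hy.1.2 (hx.2.trans hy.2.symm) hxy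
        have h3 := opp x z hx.1.2 hz.1.2 (hx.2.trans hz.2.symm) hxz
        exact hyz (inj y z (hy.2.trans hz.2.symm)
          ((dvd_sub h1 h3).elim fun k hk ↦ ⟨k, by linear_combination hk⟩))
    _ ≤ _ := by
        gcongr
        rw [← Finset.card_range (N / p ^ 2 + 1)]
        refine Finset.card_le_card fun q hq ↦ ?_
        simp only [Finset.mem_image, Finset.mem_filter, Finset.mem_range] at hq ⊢
        obtain ⟨n, ⟨hn, -⟩, rfl⟩ := hq
        exact Nat.lt_succ_of_le (Nat.div_le_div_right hn.le)

lemma prime_bounds_of_sq_dvd {p n N : ℕ} (hp : p.Prime) (hn : n < N)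
    (h : p ^ 2 ∣ (10 * n + 7) ^ 2 + 2 ^ 2 ∨ p ^ 2 ∣ (20 * n + 14) ^ 2 + 5 ^ 2) :
    6 < p ∧ p ≤ 20 * N := by
  constructor
  · by_contra! h6
    have h' : p ∣ (10 * n + 7) ^ 2 + 2 ^ 2 ∨ p ∣ (20 * n + 14) ^ 2 + 5 ^ 2 :=
      h.imp (dvd_pow_self p two_ne_zero).trans (dvd_pow_self p two_ne_zero).trans
    rw [Nat.dvd_iff_mod_eq_zero, Nat.dvd_iff_mod_eq_zero] at h'
    have hp2 := hp.two_le
    have h4 : p ≠ 4 := by rintro rfl; revert hp; decide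
    have h6 : p ≠ 6 := by rintro rfl; revert hp; decide
    have : p = 2 ∨ p = 3 ∨ p = 5 := by omega
    rw [Nat.add_mod, Nat.pow_mod, Nat.add_mod ((20 * n + 14) ^ 2), Nat.pow_mod (20 * n + 14)] at h'
    rcases this with rfl | rfl | rfl
    · rw [show (10 * n + 7) % 2 = 1 by omega, show (20 * n + 14) % 2 = 0 by omega] at h'
      omega
    · rw [show (20 * n + 14) % 3 = 2 * ((10 * n + 7) % 3) % 3 by omega] at h'
      have : (10 * n + 7) % 3 < 3 := Nat.mod_lt _ (by norm_num)
      interval_cases (10 * n + 7) % 3 <;> norm_num at h'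
    · rw [show (10 * n + 7) % 5 = 2 by omega, show (20 * n + 14) % 5 = 4 by omega] at h'
      omega
  · have hle : p ^ 2 ≤ (20 * n + 14) ^ 2 + 5 ^ 2 := by
      rcases h with h | h
      · exact (Nat.le_of_dvd (by positivity) h).trans (by nlinarith)
      · exact Nat.le_of_dvd (by positivity) h
    by_contra! hlt
    nlinarith

open Filter in
lemma eventually_primeCounting_le_div :
    ∀ᶠ N : ℕ in atTop, (Nat.primeCounting (20 * N) : ℝ) ≤ N / 24 := by
  have h1 := Chebyshev.eventually_primeCounting_le (ε := 1) one_pos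
  have h2 := Real.tendsto_log_atTop.eventually_ge_atTop (480 * (Real.log 4 + 1))
  have ht : Tendsto (fun N : ℕ ↦ (20 * N : ℝ)) atTop atTop :=
    tendsto_natCast_atTop_atTop.const_mul_atTop (by norm_num)
  filter_upwards [ht.eventually h1, ht.eventually h2] with N h1 h2
  have : ⌊(20 * N : ℝ)⌋₊ = 20 * N := by exact_mod_cast Nat.floor_natCast (20 * N)
  rw [this] at h1
  refine h1.trans ?_
  have : 0 < Real.log 4 := Real.log_pos (by norm_num)
  rw [div_le_div_iff₀ (by linarith) (by norm_num)]
  have := mul_le_mul_of_nonneg_left h2 (Nat.cast_nonneg (α := ℝ) N)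
  linarith

lemma infinite_squarefree_pair :
    {n : ℕ | Squarefree ((10 * n + 7) ^ 2 + 2 ^ 2) ∧
      Squarefree ((20 * n + 14) ^ 2 + 5 ^ 2)}.Infinite := by
  intro hfin
  set G := hfin.toFinset with hG
  obtain ⟨N, hN, hlarge⟩ := (eventually_primeCounting_le_div.and
    (Filter.eventually_gt_atTop (6 * G.card))).exists
  set P := (Finset.Ioc 6 (20 * N)).filter Nat.Prime with hP
  let F (a b c p : ℕ) := (Finset.range N).filter fun n ↦ p ^ 2 ∣ (a * n + b) ^ 2 + c ^ 2
  have hcover : Finset.range N ⊆ G ∪ P.biUnion fun p ↦ F 10 7 2 p ∪ F 20 14 5 p := by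
    intro n hn
    rw [Finset.mem_union]
    by_contra! h
    simp only [hG, Set.Finite.mem_toFinset, Set.mem_ofPred_eq] at h
    have hex : ∃ p, p.Prime ∧
        (p ^ 2 ∣ (10 * n + 7) ^ 2 + 2 ^ 2 ∨ p ^ 2 ∣ (20 * n + 14) ^ 2 + 5 ^ 2) := by
      by_contra! hno
      refine h.1 ⟨Nat.squarefree_iff_prime_squarefree.2 fun p hp hd ↦ ?_,
        Nat.squarefree_iff_prime_squarefree.2 fun p hp hd ↦ ?_⟩
      · exact (hno p hp).1 (by rwa [sq p])
      · exact (hno p hp).2 (by rwa [sq p])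
    obtain ⟨p, hp, hd⟩ := hex
    obtain ⟨hp6, hpN⟩ := prime_bounds_of_sq_dvd hp (Finset.mem_range.1 hn) hd
    refine h.2 (Finset.mem_biUnion.2 ⟨p, by simp [hP, hp, hp6, hpN], ?_⟩)
    simpa [F, Finset.mem_range.1 hn] using hd
  have hF (p : ℕ) (hp : p ∈ P) : (F 10 7 2 p ∪ F 20 14 5 p).card ≤ 4 * (N / p ^ 2 + 1) := by
    simp only [hP, Finset.mem_filter, Finset.mem_Ioc] at hp
    obtain ⟨⟨hp6, -⟩, hp⟩ := hp
    have hnd (m : ℕ) (hm : 0 < m) (hm6 : m < 6) : ¬p ∣ m := Nat.not_dvd_of_pos_of_lt hm (by omega)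
    have h10 : ¬p ∣ 10 := fun h ↦ (hp.dvd_mul.1 (show p ∣ 2 * 5 from h)).elim
      (hnd 2 (by norm_num) (by norm_num)) (hnd 5 (by norm_num) (by norm_num))
    have h20 : ¬p ∣ 20 := fun h ↦ (hp.dvd_mul.1 (show p ∣ 2 * 10 from h)).elim
      (hnd 2 (by norm_num) (by norm_num)) h10
    have h2 := hnd 2 (by norm_num) (by norm_num)
    have h1 := card_sq_dvd_le (b := 7) hp h2 h10 h2 N
    have h3 := card_sq_dvd_le (b := 14) hp h2 h20 (hnd 5 (by norm_num) (by norm_num)) N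
    exact (Finset.card_union_le _ _).trans (by simp only [F]; omega)
  have hcard : N ≤ G.card + ∑ p ∈ P, 4 * (N / p ^ 2 + 1) := by
    calc N = (Finset.range N).card := (Finset.card_range N).symm
      _ ≤ _ := Finset.card_le_card hcover
      _ ≤ _ := Finset.card_union_le _ _
      _ ≤ _ := by
        gcongr
        exact Finset.card_biUnion_le.trans (Finset.sum_le_sum hF)
  have hPcard : (P.card : ℝ) ≤ N / 24 := by
    refine le_trans ?_ hN
    rw [← Nat.primesLE_card_eq_primeCounting]
    refine mod_cast Finset.card_le_card fun p hp ↦ ?_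
    simp only [hP, Finset.mem_filter, Finset.mem_Ioc] at hp
    exact Nat.mem_primesLE.2 ⟨hp.1.2, hp.2⟩
  have hsum : ∑ p ∈ P, ((p : ℝ) ^ 2)⁻¹ ≤ 1 / 6 := by
    calc _ ≤ ∑ p ∈ Finset.Ioc 6 (20 * N), ((p : ℝ) ^ 2)⁻¹ :=
          Finset.sum_le_sum_of_subset_of_nonneg (Finset.filter_subset _ _)
            fun _ _ _ ↦ by positivity
      _ ≤ ((6 : ℕ) : ℝ)⁻¹ - ((20 * N : ℕ) : ℝ)⁻¹ :=
          sum_Ioc_inv_sq_le_sub (by norm_num) (by omega)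
      _ ≤ 1 / 6 := by
          have : (0 : ℝ) ≤ ((20 * N : ℕ) : ℝ)⁻¹ := by positivity
          norm_num at this ⊢
  have hreal : (N : ℝ) ≤ G.card + (4 * N * ∑ p ∈ P, ((p : ℝ) ^ 2)⁻¹ + 4 * P.card) := by
    calc (N : ℝ) ≤ ((G.card + ∑ p ∈ P, 4 * (N / p ^ 2 + 1) : ℕ) : ℝ) := by exact_mod_cast hcard
      _ = G.card + ∑ p ∈ P, 4 * (((N / p ^ 2 : ℕ) : ℝ) + 1) := by push_cast; rfl
      _ ≤ G.card + ∑ p ∈ P, (4 * N * ((p : ℝ) ^ 2)⁻¹ + 4) := by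
          gcongr with p hp
          have : ((N / p ^ 2 : ℕ) : ℝ) ≤ N / p ^ 2 := by exact_mod_cast Nat.cast_div_le
          rw [div_eq_mul_inv] at this
          linarith
      _ = _ := by
          rw [Finset.sum_add_distrib, ← Finset.mul_sum, Finset.sum_const, nsmul_eq_mul]
          ring
  have hlarge' : (6 * G.card : ℝ) < N := by exact_mod_cast hlarge
  have := mul_le_mul_of_nonneg_left hsum (Nat.cast_nonneg (α := ℝ) N)
  linarith

/-- There exist infinitely many integers `t ≥ 7` such that, for a root `α` of
`h(x;t) = x⁴ − t·x³ − 3x² + t·x + 1`, the number field `ℚ(α)` is monogenic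
with power basis generated by `α`: the ring of integers (i.e. the integral
closure of `ℤ` in `ℚ(α)`) equals `ℤ[α]`. -/
theorem stmt_13 :
    {t : ℤ | 7 ≤ t ∧
      ∀ (K : Type) [Field K] [NumberField K] (α : K),
        Polynomial.aeval α
          (X ^ 4 - C (t : ℚ) * X ^ 3 - 3 * X ^ 2 + C (t : ℚ) * X + 1 : Polynomial ℚ) = 0 →
        IntermediateField.adjoin ℚ {α} = ⊤ →
        integralClosure ℤ K = Algebra.adjoin ℤ {α}}.Infinite := by
  have hinj : Function.Injective fun n : ℕ ↦ (10 * n + 7 : ℤ) := fun m n h ↦ by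
    simp only at h
    omega
  refine (infinite_squarefree_pair.image hinj.injOn).mono ?_
  rintro _ ⟨n, ⟨h1, h2⟩, rfl⟩
  refine ⟨by dsimp only; omega, fun K _ _ α hα htop ↦
    integralClosure_eq_adjoin (t := 10 * n + 7) ?_ ?_ ?_ htop⟩
  · convert Int.squarefree_natCast.2 h1 using 1
    push_cast; ring
  · convert Int.squarefree_natCast.2 h2 using 1
    push_cast; ring
  · simpa [map_ofNat] using hα
end

section
/- For all integers n ≥ 4 and t ≥ 4, the polynomial g_n(x;t) = xⁿ − (t+3)·x^{n−1} + t·x + 1 is irreducible over ℚ. -/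
open Polynomial

theorem norm_gt_of_root {T : ℝ} (hT : 0 ≤ T) {m : ℕ} (hm : 2 ≤ m) {z : ℂ} (hz : 1 ≤ ‖z‖)
    (h : z ^ (m + 1) - (T + 3) * z ^ m + T * z + 1 = 0) : T + 2 < ‖z‖ := by
  by_contra! hle
  have h1 : z ^ m * ((T + 3 : ℝ) - z) = T * z + 1 := by
    push_cast; linear_combination -h
  have h2 := congrArg norm h1
  rw [norm_mul, norm_pow] at h2
  have h3 : ‖(T * z + 1 : ℂ)‖ ≤ T * ‖z‖ + 1 := by
    refine (norm_add_le _ _).trans ?_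
    simp [abs_of_nonneg hT]
  have h4 : T + 3 - ‖z‖ ≤ ‖((T + 3 : ℝ) - z : ℂ)‖ := by
    have := norm_sub_norm_le ((T + 3 : ℝ) : ℂ) z
    rwa [Complex.norm_of_nonneg (by linarith)] at this
  have h5 : ‖z‖ ^ 2 * (T + 3 - ‖z‖) ≤ ‖z‖ ^ m * ‖((T + 3 : ℝ) - z : ℂ)‖ :=
    mul_le_mul (pow_le_pow_right₀ hz hm) h4 (by linarith) (by positivity)
  have h6 : 0 ≤ (‖z‖ - 1) * (T + 2 - ‖z‖) := mul_nonneg (by linarith) (by linarith)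
  nlinarith

theorem norm_lt_one_of_cofactor_root {T : ℝ} (hT : 0 ≤ T) {j : ℕ} {z w : ℂ} (hz : T + 2 < ‖z‖)
    (h : z ^ (j + 2) - (T + 3) * z ^ (j + 1) + T * z + 1 = 0)
    (hw : (∑ i ∈ Finset.range (j + 2), w ^ i * z ^ (j + 1 - i))
      - (T + 3) * (∑ i ∈ Finset.range (j + 1), w ^ i * z ^ (j - i)) + T = 0) : ‖w‖ < 1 := by
  by_contra! hle
  set S : ℂ := ∑ i ∈ Finset.range j, w ^ (i + 1) * z ^ (j - 1 - i) with hS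
  have hs1 : ∑ i ∈ Finset.range (j + 1), w ^ i * z ^ (j - i) = S + z ^ j := by
    rw [Finset.sum_range_succ']
    simp only [pow_zero, one_mul, Nat.sub_zero, hS]
    congr 1
    exact Finset.sum_congr rfl fun i _ => by rw [show j - (i + 1) = j - 1 - i by omega]
  have hs2 : ∑ i ∈ Finset.range (j + 2), w ^ i * z ^ (j + 1 - i)
      = z * (S + z ^ j) + w ^ (j + 1) := by
    rw [Finset.sum_range_succ, ← hs1, Finset.mul_sum]
    simp only [Nat.sub_self, pow_zero, mul_one]
    congr 1
    refine Finset.sum_congr rfl fun i hi => ?_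
    rw [show j + 1 - i = (j - i) + 1 by have := Finset.mem_range.1 hi; omega]
    ring
  rw [hs1, hs2] at hw
  have key : z ^ (j + 2) * w ^ (j + 1) = z ^ (j + 1) + z * (T * z + 1) * S := by
    linear_combination z ^ (j + 2) * hw - (z * S + z ^ (j + 1)) * h
  have hr : 1 < ‖z‖ := by linarith
  have hSn : ‖S‖ * (‖z‖ - 1) ≤ ‖w‖ ^ j * ‖z‖ ^ j := by
    have : ‖S‖ ≤ ‖w‖ ^ j * ∑ i ∈ Finset.range j, ‖z‖ ^ i := by
      rw [← Finset.sum_range_reflect, Finset.mul_sum]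
      refine (norm_sum_le _ _).trans (Finset.sum_le_sum fun i hi => ?_)
      rw [norm_mul, norm_pow, norm_pow]
      have := Finset.mem_range.1 hi
      gcongr
      exact (by omega : i + 1 ≤ j)
    calc ‖S‖ * (‖z‖ - 1) ≤ (‖w‖ ^ j * ∑ i ∈ Finset.range j, ‖z‖ ^ i) * (‖z‖ - 1) := by
          gcongr
      _ = ‖w‖ ^ j * (‖z‖ ^ j - 1) := by rw [mul_assoc, geom_sum_mul]
      _ ≤ _ := by gcongr; linarith
  have hn : ‖z‖ ^ (j + 2) * ‖w‖ ^ (j + 1) ≤ ‖z‖ ^ (j + 1) + ‖z‖ * (T * ‖z‖ + 1) * ‖S‖ := by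
    rw [← norm_pow, ← norm_pow w, ← norm_mul, key]
    refine (norm_add_le _ _).trans ?_
    rw [norm_mul, norm_mul, norm_pow]
    gcongr
    refine (norm_add_le _ _).trans ?_
    simp [abs_of_nonneg hT]
  set r := ‖z‖
  set ρ := ‖w‖
  have hρ : 1 ≤ ρ ^ j := one_le_pow₀ hle
  have h1 : r ^ (j + 2) * ρ ^ (j + 1) * (r - 1)
      ≤ r ^ (j + 1) * (r - 1) * ρ ^ j + r * (T * r + 1) * (ρ ^ j * r ^ j) := by
    calc _ ≤ (r ^ (j + 1) + r * (T * r + 1) * ‖S‖) * (r - 1) := by gcongr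
      _ = r ^ (j + 1) * (r - 1) * 1 + r * (T * r + 1) * (‖S‖ * (r - 1)) := by ring
      _ ≤ _ := by
        gcongr
  have h2 : r ^ (j + 1) * ρ ^ j * (ρ * r * (r - 1))
      ≤ r ^ (j + 1) * ρ ^ j * (r - 1 + T * r + 1) := by
    convert h1 using 1 <;> ring
  have h3 := le_of_mul_le_mul_left h2 (by positivity)
  have h4 : r * (r - 1) ≤ ρ * (r * (r - 1)) :=
    le_mul_of_one_le_left (mul_nonneg (by linarith) (by linarith)) hle
  nlinarith

theorem multiset_prod_norm_lt_one {s : Multiset ℂ} (hs : s ≠ 0) (h : ∀ z ∈ s, ‖z‖ < 1) :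
    ‖s.prod‖ < 1 := by
  induction s using Multiset.induction_on with
  | empty => exact absurd rfl hs
  | cons a s ih =>
    rw [Multiset.prod_cons, norm_mul]
    have ha := h a (Multiset.mem_cons_self a s)
    rcases eq_or_ne s 0 with rfl | h0
    · simpa using ha
    · exact mul_lt_one_of_nonneg_of_lt_one_left (norm_nonneg _) ha
        (ih h0 fun z hz => h z (Multiset.mem_cons_of_mem hz)).le

theorem exists_root_one_le_norm {p : ℂ[X]} (hp : p.Monic) (hd : p.natDegree ≠ 0)
    (h0 : 1 ≤ ‖p.coeff 0‖) : ∃ z, p.eval z = 0 ∧ 1 ≤ ‖z‖ := by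
  by_contra! h
  have hsp := IsAlgClosed.splits p
  rw [hsp.coeff_zero_eq_prod_roots_of_monic hp, norm_mul, norm_pow, norm_neg, norm_one, one_pow,
    one_mul] at h0
  refine h0.not_gt (multiset_prod_norm_lt_one ?_ fun z hz => h z (mem_roots'.1 hz).2)
  rwa [← Multiset.card_eq_zero.ne, ← hsp.natDegree_eq_card_roots]

theorem exists_complex_root_one_le_norm {p : ℤ[X]} (hp : p.Monic) (hd : p.natDegree ≠ 0)
    (h0 : p.coeff 0 ≠ 0) : ∃ z : ℂ, (p.map (Int.castRingHom ℂ)).eval z = 0 ∧ 1 ≤ ‖z‖ := by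
  refine exists_root_one_le_norm (hp.map _) (by rwa [hp.natDegree_map]) ?_
  rw [coeff_map, eq_intCast, Complex.norm_intCast]
  exact_mod_cast Int.one_le_abs h0

theorem not_one_le_norm_of_mul_eq {T : ℝ} (hT : 0 ≤ T) {j : ℕ} (hj : 1 ≤ j) {p q : ℂ[X]}
    (hpq : p * q = X ^ (j + 2) - C (T + 3 : ℂ) * X ^ (j + 1) + C (T : ℂ) * X + 1) {z w : ℂ}
    (hz : p.eval z = 0) (hz1 : 1 ≤ ‖z‖) (hw : q.eval w = 0) : ‖w‖ < 1 := by
  have hroot : z ^ (j + 2) - (T + 3) * z ^ (j + 1) + T * z + 1 = 0 := by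
    have := congrArg (eval z) hpq
    simpa [hz] using this.symm
  obtain ⟨p₁, rfl⟩ := dvd_iff_isRoot.2 hz
  set H : ℂ[X] := (∑ i ∈ Finset.range (j + 2), X ^ i * C z ^ (j + 1 - i))
      - C (T + 3 : ℂ) * (∑ i ∈ Finset.range (j + 1), X ^ i * C z ^ (j - i)) + C (T : ℂ) with hH
  have hfac : p₁ * q = H := by
    refine mul_left_cancel₀ (X_sub_C_ne_zero z) ?_
    have e1 := geom_sum₂_mul X (C z) (j + 2)
    have e2 := geom_sum₂_mul X (C z) (j + 1)
    have e3 := congrArg C hroot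
    simp only [map_add, map_sub, map_mul, map_pow, map_one, map_zero] at e3
    simp only [Nat.add_sub_cancel, show j + 2 - 1 = j + 1 by omega] at e1 e2
    rw [← mul_assoc, hpq, hH, map_add]
    linear_combination -e1 + (C (T : ℂ) + C 3) * e2 + e3
  refine norm_lt_one_of_cofactor_root hT (norm_gt_of_root hT (by omega) hz1 hroot) hroot ?_
  have := congrArg (eval w) hfac
  simpa [hw, hH, eval_finsetSum] using this.symm

/-- For all integers `n ≥ 4` and `t ≥ 4`, the polynomial
`g_n(x;t) = xⁿ − (t+3)·x^{n−1} + t·x + 1` is irreducible over `ℚ`. -/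
theorem stmt_14 (n : ℕ) (hn : 4 ≤ n) (t : ℤ) (ht : 4 ≤ t) :
    Irreducible
      (X ^ n - C ((t : ℚ) + 3) * X ^ (n - 1) + C (t : ℚ) * X + 1 : Polynomial ℚ) := by
  obtain ⟨j, rfl⟩ : ∃ j, n = j + 2 := ⟨n - 2, by omega⟩
  set G : ℤ[X] := X ^ (j + 2) - C (t + 3) * X ^ (j + 1) + C t * X + 1 with hG
  have hdeg : G.natDegree = j + 2 := by
    rw [hG]
    compute_degree!
    simp
  have hmonic : G.Monic := by
    rw [hG]
    monicity!
    omega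
  have hmap : (X ^ (j + 2) - C ((t : ℚ) + 3) * X ^ (j + 2 - 1) + C (t : ℚ) * X + 1 : ℚ[X])
      = G.map (algebraMap ℤ ℚ) := by
    simp [hG, C_ofNat]
  rw [hmap, ← hmonic.irreducible_iff_irreducible_map_fraction_map,
    hmonic.irreducible_iff_natDegree]
  refine ⟨fun h => by simp [h] at hdeg, fun p q hp hq hpq => ?_⟩
  by_contra! hd
  have h0 : p.coeff 0 * q.coeff 0 = 1 := by
    rw [← mul_coeff_zero, hpq, hG]
    simp
  obtain ⟨z, hz, hz1⟩ := exists_complex_root_one_le_norm hp hd.1 (left_ne_zero_of_mul_eq_one h0)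
  obtain ⟨w, hw, hw1⟩ := exists_complex_root_one_le_norm hq hd.2 (right_ne_zero_of_mul_eq_one h0)
  refine hw1.not_gt (not_one_le_norm_of_mul_eq (T := t) (j := j) ?_ (by omega) ?_ hz hz1 hw)
  · exact_mod_cast (by omega : 0 ≤ t)
  · rw [← Polynomial.map_mul, hpq, hG]
    simp [C_ofNat]
end

section
/- For every integer t ≥ 4, the quartic polynomial g₄(x;t) = x⁴ − (t+3)·x³ + t·x + 1 has four distinct real roots, and hence the quartic number field L = ℚ(α) generated by a root α of g₄(x;t) has unit group of rank 3. -/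
open Polynomial

/-- The polynomial `X ^ 4 - (s + 3) X ^ 3 + s X + 1`. -/
noncomputable def quarticPoly {R : Type*} [CommRing R] (s : R) : R[X] :=
  X ^ 4 - C (s + 3) * X ^ 3 + C s * X + 1

section CommRing

variable {R : Type*} [CommRing R]

lemma map_quarticPoly {S : Type*} [CommRing S] (f : R →+* S) (s : R) :
    (quarticPoly s).map f = quarticPoly (f s) := by
  simp [quarticPoly, map_ofNat f 3]

lemma natDegree_quarticPoly [Nontrivial R] (s : R) : (quarticPoly s).natDegree = 4 := by
  unfold quarticPoly
  compute_degree!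

lemma monic_quarticPoly [Nontrivial R] (s : R) : (quarticPoly s).Monic := by
  unfold quarticPoly
  monicity!

end CommRing

lemma irreducible_quarticPoly_int (t : ℤ) : Irreducible (quarticPoly t) := by
  have hm := monic_quarticPoly t
  rw [hm.irreducible_iff_natDegree', natDegree_quarticPoly]
  refine ⟨fun h => by simpa [h] using natDegree_quarticPoly t, fun f g hf hg hfg hdeg => ?_⟩
  have hsum : f.natDegree + g.natDegree = 4 := by
    rw [← hf.natDegree_mul hg, hfg, natDegree_quarticPoly]
  obtain h | h : g.natDegree = 1 ∨ g.natDegree = 2 := by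
    simp only [Finset.mem_Ioc] at hdeg
    omega
  · have hg1 : g = X + C (g.coeff 0) := by
      have h1 : g.coeff 1 = 1 := h ▸ hg.coeff_natDegree
      conv_lhs => rw [eq_X_add_C_of_natDegree_le_one h.le, h1]
      simp
    have hroot : (quarticPoly t).eval (-g.coeff 0) = 0 := by
      rw [← hfg, hg1]
      simp
    generalize g.coeff 0 = c at hroot
    simp only [quarticPoly, eval_add, eval_sub, eval_mul, eval_pow, eval_X, eval_C,
      eval_one] at hroot
    have hc : c * (c ^ 3 + (t + 3) * c ^ 2 - t) = -1 := by linear_combination hroot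
    obtain rfl | rfl : c = 1 ∨ c = -1 :=
      Int.isUnit_iff.1 (IsUnit.of_mul_eq_one (-(c ^ 3 + (t + 3) * c ^ 2 - t))
        (by linear_combination -hc))
    · ring_nf at hroot
      omega
    · ring_nf at hroot
      omega
  · have quadratic : ∀ p : ℤ[X], p.Monic → p.natDegree = 2 →
        p = X ^ 2 + C (p.coeff 1) * X + C (p.coeff 0) := by
      intro p hp hp2
      have h2 : p.coeff 2 = 1 := hp2 ▸ hp.coeff_natDegree
      conv_lhs => rw [p.as_sum_range_C_mul_X_pow, hp2]
      simp only [Finset.sum_range_succ, Finset.sum_range_zero, h2, C_1]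
      ring
    have hf2 := quadratic f hf (by omega)
    have hg2 := quadratic g hg h
    generalize f.coeff 1 = a at hf2
    generalize f.coeff 0 = b at hf2
    generalize g.coeff 1 = c at hg2
    generalize g.coeff 0 = d at hg2
    have hev : ∀ x : ℤ, (x ^ 2 + a * x + b) * (x ^ 2 + c * x + d) =
        x ^ 4 - (t + 3) * x ^ 3 + t * x + 1 := by
      intro x
      have := congrArg (eval x) hfg
      rw [hf2, hg2] at this
      simpa [quarticPoly] using this
    have h0 := hev 0
    have h1 := hev 1
    have h1' := hev (-1)
    have h2 := hev 2
    have hbd : b * d = 1 := by linear_combination h0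
    have hs : a + c = -(t + 3) := by linarith
    have hl : a * d + b * c = t := by linarith
    rcases Int.eq_one_or_neg_one_of_mul_eq_one' hbd with ⟨rfl, rfl⟩ | ⟨rfl, rfl⟩ <;> omega

lemma irreducible_quarticPoly_rat (t : ℤ) : Irreducible (quarticPoly (t : ℚ)) := by
  have := ((monic_quarticPoly t).irreducible_iff_irreducible_map_fraction_map (K := ℚ)).1
    (irreducible_quarticPoly_int t)
  simpa [map_quarticPoly] using this

lemma exists_roots_quarticPoly {t : ℝ} (ht : 4 ≤ t) :
    ∃ s : Finset ℝ, s.card = 4 ∧ (quarticPoly t).roots = s.val := by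
  have hc : Continuous fun x => (quarticPoly t).eval x := (quarticPoly t).continuous
  have hev (x : ℝ) : (quarticPoly t).eval x = x ^ 4 - (t + 3) * x ^ 3 + t * x + 1 := by
    simp [quarticPoly]
  have hn1 : 0 < (quarticPoly t).eval (-1) := by rw [hev]; linarith
  have hn2 : (quarticPoly t).eval (-1 / 2) < 0 := by rw [hev]; linarith
  have h0 : 0 < (quarticPoly t).eval 0 := by rw [hev]; linarith
  have h1 : (quarticPoly t).eval 1 < 0 := by rw [hev]; linarith
  have ht3 : 0 < (quarticPoly t).eval (t + 3) := by rw [hev]; nlinarith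
  obtain ⟨a, ha, hra⟩ := intermediate_value_Ioo' (by norm_num) hc.continuousOn ⟨hn2, hn1⟩
  obtain ⟨b, hb, hrb⟩ := intermediate_value_Ioo (by norm_num) hc.continuousOn ⟨hn2, h0⟩
  obtain ⟨c, hc', hrc⟩ := intermediate_value_Ioo' (by norm_num) hc.continuousOn ⟨h1, h0⟩
  obtain ⟨d, hd, hrd⟩ := intermediate_value_Ioo (by linarith) hc.continuousOn ⟨h1, ht3⟩
  have hab : a < b := ha.2.trans hb.1
  have hbc : b < c := hb.2.trans hc'.1
  have hcd : c < d := hc'.2.trans hd.1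
  have hcard : ({a, b, c, d} : Finset ℝ).card = 4 := by
    rw [Finset.card_insert_of_notMem, Finset.card_insert_of_notMem, Finset.card_pair hcd.ne]
    · simp [hbc.ne, (hbc.trans hcd).ne]
    · simp [hab.ne, (hab.trans hbc).ne, (hab.trans (hbc.trans hcd)).ne]
  refine ⟨{a, b, c, d}, hcard, (Multiset.eq_of_le_of_card_le ?_ ?_).symm⟩
  · rw [Multiset.le_iff_subset (Finset.nodup _)]
    intro x hx
    rw [mem_roots (monic_quarticPoly t).ne_zero, IsRoot.def]
    have hx' : x = a ∨ x = b ∨ x = c ∨ x = d := by simpa using hx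
    rcases hx' with rfl | rfl | rfl | rfl <;> assumption
  · rw [Finset.card_val, hcard, ← natDegree_quarticPoly t]
    exact card_roots' _

lemma im_eq_zero_of_aeval_quarticPoly {t : ℝ} (ht : 4 ≤ t) {z : ℂ}
    (hz : aeval z (quarticPoly t) = 0) : z.im = 0 := by
  obtain ⟨s, hs, hroots⟩ := exists_roots_quarticPoly ht
  have hsplit := prod_multiset_X_sub_C_of_monic_of_roots_card_eq (monic_quarticPoly t)
    (by rw [hroots, Finset.card_val, hs, natDegree_quarticPoly])
  rw [← hsplit, hroots, Finset.prod_map_val, map_prod, Finset.prod_eq_zero_iff] at hz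
  obtain ⟨r, -, hr⟩ := hz
  have hzr : z = r := by simpa [sub_eq_zero] using hr
  simp [hzr]

section NumberField

variable {L : Type*} [Field L] [NumberField L] {α : L} {t : ℤ}

lemma isTotallyReal_of_aeval_quarticPoly (ht : 4 ≤ t)
    (hα : aeval α (quarticPoly (t : ℚ)) = 0) (htop : IntermediateField.adjoin ℚ {α} = ⊤) :
    NumberField.IsTotallyReal L where
  isReal v := by
    rw [NumberField.InfinitePlace.isReal_iff]
    have hroot (φ : L →ₐ[ℚ] ℂ) : (φ α).im = 0 := by
      apply im_eq_zero_of_aeval_quarticPoly (t := (t : ℝ)) (by exact_mod_cast ht)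
      have := congrArg φ hα
      simpa [quarticPoly, map_ofNat φ 3] using this
    rw [NumberField.ComplexEmbedding.isReal_iff]
    set φ := v.embedding.toRatAlgHom
    have h : (NumberField.ComplexEmbedding.conjugate v.embedding).toRatAlgHom = φ := by
      refine AlgHom.ext_of_adjoin_eq_top (s := {α}) ?_ ?_
      · rw [← IntermediateField.adjoin_simple_toSubalgebra_of_isAlgebraic
          (Algebra.IsAlgebraic.isAlgebraic α), htop, IntermediateField.top_toSubalgebra]
      · rintro x rfl
        exact Complex.conj_eq_iff_im.2 (hroot φ)
    ext x
    exact DFunLike.congr_fun h x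

lemma finrank_of_aeval_quarticPoly
    (hα : aeval α (quarticPoly (t : ℚ)) = 0) (htop : IntermediateField.adjoin ℚ {α} = ⊤) :
    Module.finrank ℚ L = 4 := by
  rw [← IntermediateField.finrank_top', ← htop,
    IntermediateField.adjoin.finrank (Algebra.IsIntegral.isIntegral α),
    ← minpoly.eq_of_irreducible_of_monic (irreducible_quarticPoly_rat t) hα
      (monic_quarticPoly _), natDegree_quarticPoly]

lemma unitsRank_of_aeval_quarticPoly (ht : 4 ≤ t)
    (hα : aeval α (quarticPoly (t : ℚ)) = 0) (htop : IntermediateField.adjoin ℚ {α} = ⊤) :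
    NumberField.Units.rank L = 3 := by
  have := isTotallyReal_of_aeval_quarticPoly ht hα htop
  rw [NumberField.Units.rank,
    NumberField.InfinitePlace.card_eq_nrRealPlaces_add_nrComplexPlaces,
    NumberField.IsTotallyReal.nrComplexPlaces_eq_zero, ← NumberField.IsTotallyReal.finrank,
    finrank_of_aeval_quarticPoly hα htop]

end NumberField

/-- For every integer `t ≥ 4`, the quartic `g₄(x;t) = x⁴ − (t+3)·x³ + t·x + 1`
has four distinct real roots (its multiset of real roots has 4 elements with no
repetitions), and hence the quartic number field `L = ℚ(α)` generated by a root
`α` has unit group of rank 3. -/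
theorem stmt_16 (t : ℤ) (ht : 4 ≤ t) :
    ((X ^ 4 - C ((t : ℝ) + 3) * X ^ 3 + C (t : ℝ) * X + 1 : Polynomial ℝ).roots.card = 4 ∧
      (X ^ 4 - C ((t : ℝ) + 3) * X ^ 3 + C (t : ℝ) * X + 1 : Polynomial ℝ).roots.Nodup) ∧
    (∀ (L : Type) [Field L] [NumberField L] (α : L),
      Polynomial.aeval α
        (X ^ 4 - C ((t : ℚ) + 3) * X ^ 3 + C (t : ℚ) * X + 1 : Polynomial ℚ) = 0 →
      IntermediateField.adjoin ℚ {α} = ⊤ →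
      NumberField.Units.rank L = 3) := by
  obtain ⟨s, hs, hroots⟩ := exists_roots_quarticPoly (t := (t : ℝ)) (by exact_mod_cast ht)
  rw [quarticPoly] at hroots
  refine ⟨?_, fun L _ _ α hα htop => unitsRank_of_aeval_quarticPoly ht hα htop⟩
  rw [hroots]
  exact ⟨hs, s.nodup⟩
end

section
/- Let t ≥ 3 be an integer. If (t² − 4)·(4t² + 9) is a perfect square (i.e., equals N² for some integer N), then t = 3. -/
/-- If `u` is prime to `5` and `u * (4 * u + 5 ^ k)` is a square with `0 ≤ u`, then both factors
are squares of nonnegative integers. -/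
theorem exists_sq_of_mul_eq_sq {u M : ℤ} (k : ℕ) (hu : 0 ≤ u) (h5 : ¬ 5 ∣ u)
    (h : u * (4 * u + 5 ^ k) = M ^ 2) :
    ∃ a b : ℤ, 0 ≤ a ∧ 0 ≤ b ∧ u = a ^ 2 ∧ 4 * u + 5 ^ k = b ^ 2 := by
  have hp : Prime (5 : ℤ) := by norm_num
  have hc : IsCoprime u (5 ^ k) := ((hp.coprime_iff_not_dvd.mpr h5).pow_left).symm
  have hc' : IsCoprime u (4 * u + 5 ^ k) := by
    have := hc.add_mul_left_right 4
    rwa [show (5 : ℤ) ^ k + u * 4 = 4 * u + 5 ^ k by ring] at this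
  have hpos : (0 : ℤ) < 5 ^ k := by positivity
  obtain ⟨a, ha⟩ := Int.sq_of_isCoprime hc' h
  obtain ⟨b, hb⟩ := Int.sq_of_isCoprime hc'.symm (by rw [mul_comm]; exact h)
  refine ⟨|a|, |b|, abs_nonneg a, abs_nonneg b, ?_, ?_⟩
  · rw [sq_abs]
    rcases ha with ha | ha
    · exact ha
    · nlinarith [sq_nonneg a]
  · rw [sq_abs]
    rcases hb with hb | hb
    · exact hb
    · nlinarith [sq_nonneg b]

/-- For `t ≥ 3`, the integer `t ^ 2 - 4` is not a perfect square. -/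
theorem sq_sub_four_ne_sq {t a : ℤ} (ht : 3 ≤ t) : t ^ 2 - 4 ≠ a ^ 2 := by
  intro h
  rw [← sq_abs a] at h
  have ha := abs_nonneg a
  generalize |a| = b at h ha
  have h1 : b < t := by nlinarith
  obtain h2 | h2 : b = t - 1 ∨ b ≤ t - 2 := by omega
  · subst h2
    have : 2 * t = 5 := by linarith
    omega
  · nlinarith

/-- Let `t ≥ 3` be an integer. If `(t² − 4)·(4t² + 9)` is a perfect square,
then `t = 3`. -/
theorem stmt_19 (t : ℤ) (ht : 3 ≤ t)
    (h : ∃ N : ℤ, (t ^ 2 - 4) * (4 * t ^ 2 + 9) = N ^ 2) : t = 3 := by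
  obtain ⟨N, hN⟩ := h
  have hp : Prime (5 : ℤ) := by norm_num
  have hpos : 0 < t ^ 2 - 4 := by nlinarith
  by_cases h5 : (5 : ℤ) ∣ t ^ 2 - 4
  · obtain ⟨u, hu⟩ := h5
    have hN' : N ^ 2 = 25 * (u * (4 * u + 5)) := by
      rw [← hN, hu, show 4 * t ^ 2 + 9 = 5 * (4 * u + 5) by linarith]
      ring
    obtain ⟨M, rfl⟩ : (5 : ℤ) ∣ N :=
      hp.dvd_of_dvd_pow (n := 2) ⟨5 * (u * (4 * u + 5)), by rw [hN']; ring⟩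
    have hM : u * (4 * u + 5) = M ^ 2 := by linarith
    by_cases h5' : (5 : ℤ) ∣ u
    · obtain ⟨w, rfl⟩ := h5'
      obtain ⟨K, rfl⟩ : (5 : ℤ) ∣ M :=
        hp.dvd_of_dvd_pow (n := 2) ⟨5 * (w * (4 * w + 1)), by rw [← hM]; ring⟩
      have hc : IsCoprime w (4 * w + 1) := ⟨-4, 1, by ring⟩
      obtain ⟨a, ha | ha⟩ := Int.sq_of_isCoprime hc (c := K) (by linarith)
      · exact absurd (by rw [hu, ha]; ring) (sq_sub_four_ne_sq ht (a := 5 * a))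
      · nlinarith [sq_nonneg a]
    · obtain ⟨a, b, ha, hb, hua, hub⟩ :=
        exists_sq_of_mul_eq_sq 1 (by linarith) h5' (by rw [pow_one]; exact hM)
      rw [pow_one] at hub
      have hab : 2 * a + 1 ≤ b := by
        by_contra! hlt
        nlinarith
      have ha1 : a ≤ 1 := by nlinarith
      have hu1 : u ≤ 1 := by nlinarith
      nlinarith
  · obtain ⟨a, -, -, -, ha, -⟩ := exists_sq_of_mul_eq_sq (M := N) 2 hpos.le h5 (by linarith)
    exact absurd ha (sq_sub_four_ne_sq ht)
end
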